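/- Converse direction of Younsi's theorem. Let n ≥ 1, let A(z) = μ·∏_{k=1}^n (z − a_k)/(1 − conj(a_k)·z) and B(z) = λ·∏_{k=1}^n (z − b_k)/(1 − conj(b_k)·z) be finite Blaschke products of degree n with a_1, …, a_n, b_1, …, b_n ∈ 𝔻 and |λ| = |μ| = 1, and suppose a_j = 0 for at least one index j (so that A(∞) = ∞). Let k : 𝕋 → 𝕋 be an orientation-preserving homeomorphism of the unit circle — i.e. k(e^{iθ}) = e^{iK(θ)} for some continuous strictly increasing K : ℝ → ℝ with K(θ + 2π) = K(θ) + 2π — such that A(k(z)) = B(z) for all z ∈ 𝕋. Then there exist coprime polynomials P₁, P₂ ∈ ℂ[X] with deg P₁ = n and deg P₂ < n, and a conformal parametrization pair (φ₋, φ₊) for Γ := {z ∈ ℂ : |P₁(z)| = |P₂(z)|}, such that φ₊(k(z)) = φ₋(z) for every z ∈ 𝕋; that is, the rational function R = P₁/P₂ of degree n with R(∞) = ∞ has lemniscate L_R(1) = Γ a Jordan curve admitting k as its fingerprint. -/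

import Mathlib

open Complex Metric Set Polynomial

/-- A conformal parametrization pair for a Jordan curve `Γ ⊂ ℂ`. -/
structure ConformalPair (Γ : Set ℂ) (φm φp : ℂ → ℂ) : Prop where
  contm : ContinuousOn φm (closedBall 0 1)
  injm : InjOn φm (closedBall 0 1)
  holm : DifferentiableOn ℂ φm (ball 0 1)
  mapm : φm '' (sphere 0 1) = Γ
  contp : ContinuousOn φp {w : ℂ | 1 ≤ ‖w‖}
  injp : InjOn φp {w : ℂ | 1 ≤ ‖w‖}
  holp : DifferentiableOn ℂ φp {w : ℂ | 1 < ‖w‖}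
  mapp : φp '' (sphere 0 1) = Γ
  deriv_infty : ∃ d : ℝ, 0 < d ∧
    Filter.Tendsto (fun w => φp w / w) (Bornology.cobounded ℂ) (nhds (d : ℂ))
  disj_mp : Disjoint (φm '' ball 0 1) (φp '' {w : ℂ | 1 < ‖w‖})
  disj_mG : Disjoint (φm '' ball 0 1) Γ
  disj_pG : Disjoint (φp '' {w : ℂ | 1 < ‖w‖}) Γ
  union_eq : φm '' ball 0 1 ∪ Γ ∪ φp '' {w : ℂ | 1 < ‖w‖} = univ

open Filter Topology

/-- An orientation-reversing analytic circle map with a lift to the line. -/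
structure CircleFlip (s : ℂ → ℂ) (S : ℝ → ℝ) : Prop where
  cont : Continuous S
  anti : StrictAnti S
  per : ∀ θ, S (θ + 2 * Real.pi) = S θ - 2 * Real.pi
  lift : ∀ θ : ℝ, s (Complex.exp (θ * I)) = Complex.exp (S θ * I)
  an : AnalyticOnNhd ℂ s (sphere 0 1)
  flip : ∀ z, ‖z‖ = 1 → ∀ᶠ w in 𝓝 z, 1 < ‖w‖ → ‖s w‖ < 1

/-- Two mutually inverse orientation-reversing analytic circle diffeomorphisms, viewed as the
gluing of two closed disks along their boundary. -/
structure Weld (s t : ℂ → ℂ) (S T : ℝ → ℝ) : Prop where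
  left : CircleFlip s S
  right : CircleFlip t T
  inv_left : ∀ θ, T (S θ) = θ
  inv_right : ∀ θ, S (T θ) = θ

theorem exists_exp_of_norm_eq_one {z : ℂ} (hz : ‖z‖ = 1) : ∃ θ : ℝ, z = Complex.exp (θ * I) :=
  ⟨Complex.arg z, by
    have := Complex.norm_mul_exp_arg_mul_I z
    rw [hz] at this; simpa using this.symm⟩

namespace Weld

variable {s t : ℂ → ℂ} {S T : ℝ → ℝ}

theorem symm (W : Weld s t S T) : Weld t s T S :=
  ⟨W.right, W.left, W.inv_right, W.inv_left⟩

theorem norm_eq_one (W : Weld s t S T) {z : ℂ} (hz : ‖z‖ = 1) : ‖s z‖ = 1 := by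
  obtain ⟨θ, rfl⟩ := exists_exp_of_norm_eq_one hz
  rw [W.left.lift, Complex.norm_exp_ofReal_mul_I]

theorem ne_zero (W : Weld s t S T) {z : ℂ} (hz : ‖z‖ = 1) : s z ≠ 0 := by
  rw [← norm_pos_iff, W.norm_eq_one hz]; exact one_pos

theorem left_inverse (W : Weld s t S T) {z : ℂ} (hz : ‖z‖ = 1) : t (s z) = z := by
  obtain ⟨θ, rfl⟩ := exists_exp_of_norm_eq_one hz
  rw [W.left.lift, W.right.lift, W.inv_left]

end Weld

theorem frequently_norm_eq_one {q : ℂ} (hq : ‖q‖ = 1) : ∃ᶠ z in 𝓝[≠] q, ‖z‖ = 1 := by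
  have hc : Tendsto (fun θ : ℝ => q * Complex.exp (θ * I)) (𝓝[>] 0) (𝓝[≠] q) := by
    refine tendsto_nhdsWithin_iff.2 ⟨?_, ?_⟩
    · have : Continuous (fun θ : ℝ => q * Complex.exp (θ * I)) := by fun_prop
      have h := this.tendsto 0
      simp only [ofReal_zero, zero_mul, Complex.exp_zero, mul_one] at h
      exact h.mono_left nhdsWithin_le_nhds
    · have : Ioo (0 : ℝ) (2 * Real.pi) ∈ 𝓝[>] (0 : ℝ) := Ioo_mem_nhdsGT (by positivity)
      filter_upwards [this] with θ hθ h
      have hq0 : q ≠ 0 := by rw [← norm_pos_iff, hq]; exact one_pos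
      have h1 : Complex.exp (θ * I) = 1 := by
        have : q * Complex.exp (θ * I) = q * 1 := by simpa using h
        exact mul_left_cancel₀ hq0 this
      obtain ⟨n, hn⟩ := Complex.exp_eq_one_iff.1 h1
      have h2 : (θ : ℂ) = n * (2 * Real.pi) := by
        have : (θ : ℂ) * I = (n * (2 * Real.pi)) * I := by rw [hn]; ring
        exact mul_right_cancel₀ I_ne_zero this
      have h3 : θ = n * (2 * Real.pi) := by exact_mod_cast h2
      have hp : (0 : ℝ) < 2 * Real.pi := by positivity
      rw [h3] at hθ
      have h4 : (0 : ℝ) < n := by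
        by_contra hcon
        have := mul_nonpos_of_nonpos_of_nonneg (not_lt.1 hcon) hp.le
        linarith [hθ.1]
      have h5 : (n : ℝ) < 1 := by
        by_contra hcon
        have := mul_le_mul_of_nonneg_right (not_lt.1 hcon) hp.le
        linarith [hθ.2]
      have h6 : (0 : ℤ) < n := by exact_mod_cast h4
      have h7 : (n : ℤ) < 1 := by exact_mod_cast h5
      lia
  refine hc.frequently (Eventually.frequently (Eventually.of_forall fun θ => ?_))
  rw [norm_mul, hq, Complex.norm_exp_ofReal_mul_I, one_mul]

theorem eventuallyEq_of_eq_on_circle {f g : ℂ → ℂ} {q : ℂ} (hq : ‖q‖ = 1)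
    (hf : AnalyticAt ℂ f q) (hg : AnalyticAt ℂ g q) (h : ∀ᶠ z in 𝓝 q, ‖z‖ = 1 → f z = g z) :
    f =ᶠ[𝓝 q] g := by
  refine (hf.frequently_eq_iff_eventually_eq hg).1 ?_
  exact ((frequently_norm_eq_one hq).and_eventually
    (h.filter_mono nhdsWithin_le_nhds)).mono fun z hz => hz.2 hz.1

theorem diffContOnCl_of_analyticOnNhd {f : ℂ → ℂ} (hf : AnalyticOnNhd ℂ f (closedBall 0 1)) :
    DiffContOnCl ℂ f (ball 0 1) := by
  apply DifferentiableOn.diffContOnCl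
  rw [closure_ball _ one_ne_zero]
  exact hf.differentiableOn

theorem eq_on_closedBall_of_eq_on_circle {f g : ℂ → ℂ} (hf : AnalyticOnNhd ℂ f (closedBall 0 1))
    (hg : AnalyticOnNhd ℂ g (closedBall 0 1)) (h : ∀ z, ‖z‖ = 1 → f z = g z)
    {z : ℂ} (hz : ‖z‖ ≤ 1) : f z = g z := by
  have := Complex.eqOn_closure_of_eqOn_frontier isBounded_ball
    (diffContOnCl_of_analyticOnNhd hf) (diffContOnCl_of_analyticOnNhd hg)
    (fun z hz => h z (by simpa [frontier_ball] using hz))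
  rw [closure_ball _ one_ne_zero] at this
  exact this (by simpa using hz)

theorem exists_norm_le_on_circle {f : ℂ → ℂ} (hf : AnalyticOnNhd ℂ f (closedBall 0 1)) :
    ∃ q, ‖q‖ = 1 ∧ ∀ z, ‖z‖ ≤ 1 → ‖f z‖ ≤ ‖f q‖ := by
  obtain ⟨q, hq, hm⟩ := Complex.exists_mem_frontier_isMaxOn_norm (isBounded_ball (x := (0 : ℂ)) (r := 1))
    ⟨0, by simp⟩ (diffContOnCl_of_analyticOnNhd hf)
  rw [closure_ball _ one_ne_zero] at hm
  exact ⟨q, by simpa [frontier_ball] using hq, fun z hz => hm (by simpa using hz)⟩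

theorem AnalyticOnNhd.dslope {f : ℂ → ℂ} {U : Set ℂ} (hf : AnalyticOnNhd ℂ f U) (p : ℂ) (hp : p ∈ U) :
    AnalyticOnNhd ℂ (dslope f p) U := by
  intro z hz
  rcases eq_or_ne z p with rfl | hne
  · obtain ⟨P, hP⟩ := hf z hz
    exact ⟨_, hP.has_fpower_series_dslope_fslope⟩
  · have : _root_.dslope f p =ᶠ[𝓝 z] fun w => (w - p)⁻¹ * (f w - f p) := by
      filter_upwards [isOpen_ne.mem_nhds hne] with w hw
      rw [dslope_of_ne _ hw, slope_def_field]; field_simp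
    refine AnalyticAt.congr ?_ this.symm
    have := hf z hz
    have h0 : z - p ≠ 0 := sub_ne_zero.2 hne
    fun_prop (disch := assumption)

namespace Weld

variable {s t : ℂ → ℂ} {S T : ℝ → ℝ}

/-- Holomorphic functions on the welded sphere are constant. -/
theorem liouville (W : Weld s t S T) {F G : ℂ → ℂ} (hF : AnalyticOnNhd ℂ F (closedBall 0 1))
    (hG : AnalyticOnNhd ℂ G (closedBall 0 1)) (h : ∀ z, ‖z‖ = 1 → F z = G (s z)) :
    ∃ c, ∀ z, ‖z‖ ≤ 1 → F z = c ∧ G z = c := by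
  obtain ⟨q, hq, hqm⟩ := exists_norm_le_on_circle hF
  have hGF : ∀ z, ‖z‖ = 1 → G z = F (t z) := fun z hz => by
    rw [h _ (W.symm.norm_eq_one hz), W.symm.left_inverse hz]
  have hGm : ∀ z, ‖z‖ ≤ 1 → ‖G z‖ ≤ ‖F q‖ := by
    obtain ⟨p, hp, hpm⟩ := exists_norm_le_on_circle hG
    intro z hz
    refine (hpm z hz).trans ?_
    rw [hGF p hp]
    exact hqm _ (W.symm.norm_eq_one hp).le
  have hqc : q ∈ closedBall (0 : ℂ) 1 := by simp [hq]
  have hev : F =ᶠ[𝓝 q] fun z => G (s z) := by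
    refine eventuallyEq_of_eq_on_circle hq (hF q hqc) ?_ (Eventually.of_forall h)
    exact AnalyticAt.comp (hG _ (by simp [W.norm_eq_one hq])) (W.left.an q (by simp [hq]))
  have hmax : IsLocalMax (norm ∘ F) q := by
    filter_upwards [hev, W.left.flip q hq] with z hz hz2
    rcases le_or_gt ‖z‖ 1 with h1 | h1
    · exact hqm z h1
    · simp only [Function.comp, hz]
      exact hGm _ (hz2 h1).le
  have hconst : ∀ᶠ z in 𝓝 q, F z = F q :=
    Complex.eventually_eq_of_isLocalMax_norm
      ((hF q hqc).eventually_analyticAt.mono fun z hz => hz.differentiableAt) hmax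
  have hFc : EqOn F (fun _ => F q) (closedBall 0 1) :=
    hF.eqOn_of_preconnected_of_eventuallyEq analyticOnNhd_const
      (convex_closedBall _ _).isPreconnected hqc hconst
  refine ⟨F q, fun z hz => ⟨hFc (by simpa using hz), ?_⟩⟩
  refine eq_on_closedBall_of_eq_on_circle hG (analyticOnNhd_const (v := F q)) (fun w hw => ?_) hz
  rw [hGF w hw]
  exact hFc (by simp [W.symm.norm_eq_one hw])

/-- A function on the welded sphere with a simple pole at the center of the second disk is
Möbius-related to one with a simple pole at `p` in the first disk. -/
theorem exists_relation (W : Weld s t S T) {F G H K : ℂ → ℂ}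
    (hF : AnalyticOnNhd ℂ F (closedBall 0 1)) (hG : AnalyticOnNhd ℂ G (closedBall 0 1))
    (hH : AnalyticOnNhd ℂ H (closedBall 0 1)) (hK : AnalyticOnNhd ℂ K (closedBall 0 1))
    {p : ℂ} (hp : ‖p‖ < 1)
    (hFG : ∀ z, ‖z‖ = 1 → F z = 1 / s z + G (s z))
    (hHK : ∀ z, ‖z‖ = 1 → 1 / (z - p) + H z = K (s z)) :
    ∃ β : ℂ, β ≠ 0 ∧ ∀ z, ‖z‖ ≤ 1 → dslope F p z * (1 + (z - p) * (H z - K 0)) = β ∧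
      (1 + z * G z - z * F p) * dslope K 0 z = β := by
  have hpc : p ∈ closedBall (0 : ℂ) 1 := by simpa using hp.le
  have h0c : (0 : ℂ) ∈ closedBall (0 : ℂ) 1 := by simp
  have hid : AnalyticOnNhd ℂ (fun z : ℂ => z) (closedBall 0 1) := analyticOnNhd_id
  have hdF := hF.dslope p hpc
  have hdK := hK.dslope 0 h0c
  have e1 : ∀ z, (z - p) * dslope F p z = F z - F p := fun z => by
    simpa using sub_smul_dslope F p z
  have e2 : ∀ z, z * dslope K 0 z = K z - K 0 := fun z => by
    simpa using sub_smul_dslope K 0 z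
  have hA1 : AnalyticOnNhd ℂ (fun z => dslope F p z * (1 + (z - p) * (H z - K 0)))
      (closedBall 0 1) :=
    hdF.mul (analyticOnNhd_const.add ((hid.sub analyticOnNhd_const).mul
      (hH.sub analyticOnNhd_const)))
  have hA2 : AnalyticOnNhd ℂ (fun z => (1 + z * G z - z * F p) * dslope K 0 z)
      (closedBall 0 1) :=
    ((analyticOnNhd_const.add (hid.mul hG)).sub (hid.mul analyticOnNhd_const)).mul hdK
  have hzp : ∀ z : ℂ, ‖z‖ = 1 → z - p ≠ 0 := fun z hz h => by
    rw [sub_eq_zero] at h; subst h; linarith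
  obtain ⟨β, hβ⟩ := W.liouville hA1 hA2 (fun z hz => by
    have hs := W.ne_zero hz
    have hz' := hzp z hz
    have h1 : dslope F p z = (F z - F p) / (z - p) := by rw [← e1 z]; field_simp
    have h2 : dslope K 0 (s z) = (K (s z) - K 0) / s z := by rw [← e2]; field_simp
    simp only [h1, h2]
    rw [← hHK z hz, hFG z hz]
    field_simp
    ring)
  refine ⟨β, ?_, hβ⟩
  rintro rfl
  have hKc : ∀ᶠ z in 𝓝 (0 : ℂ), dslope K 0 z = 0 := by
    have hc : ContinuousAt (fun z : ℂ => 1 + z * G z - z * F p) 0 := by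
      have := (hG 0 h0c).continuousAt
      fun_prop
    have hne := hc.eventually_ne (y := 0) (by simp)
    filter_upwards [hne, ball_mem_nhds (0 : ℂ) one_pos] with z hz hz1
    have hz1' : ‖z‖ < 1 := by simpa using hz1
    exact (mul_eq_zero.1 (hβ z hz1'.le).2).resolve_left hz
  have hKz : EqOn (dslope K 0) 0 (closedBall 0 1) :=
    hdK.eqOn_zero_of_preconnected_of_eventuallyEq_zero
      (convex_closedBall _ _).isPreconnected h0c hKc
  have hK0 : ∀ z, ‖z‖ ≤ 1 → K z = K 0 := fun z hz => by
    have := e2 z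
    rw [hKz (by simpa using hz)] at this
    simpa [sub_eq_zero] using this.symm
  have hB : AnalyticOnNhd ℂ (fun z => 1 + (z - p) * (H z - K 0)) (closedBall 0 1) :=
    analyticOnNhd_const.add ((hid.sub analyticOnNhd_const).mul (hH.sub analyticOnNhd_const))
  have := eq_on_closedBall_of_eq_on_circle hB (analyticOnNhd_const (v := (0 : ℂ)))
    (fun z hz => by
      have h1 := hHK z hz
      rw [hK0 _ (W.norm_eq_one hz).le] at h1
      have := hzp z hz
      rw [← h1]; field_simp; ring) hp.le
  simp at this

end Weld

theorem exists_annulus {p : ℂ → Prop} (h : ∀ z, ‖z‖ = 1 → ∀ᶠ w in 𝓝 z, p w) :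
    ∃ ε : ℝ, 0 < ε ∧ ε < 1 ∧ ∀ z : ℂ, |‖z‖ - 1| < ε → p z := by
  have hU : {z : ℂ | p z} ∈ 𝓝ˢ (sphere (0 : ℂ) 1) := by
    rw [mem_nhdsSet_iff_forall]
    exact fun z hz => h z (by simpa using hz)
  obtain ⟨U, hUo, hsU, hUp⟩ := mem_nhdsSet_iff_exists.1 hU
  obtain ⟨δ, hδ, hsub⟩ := (isCompact_sphere (0 : ℂ) 1).exists_thickening_subset_open hUo hsU
  refine ⟨min δ (1 / 2), by positivity, lt_of_le_of_lt (min_le_right _ _) (by norm_num), ?_⟩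
  intro z hz
  have h1 : |‖z‖ - 1| < δ := hz.trans_le (min_le_left _ _)
  have h2 : |‖z‖ - 1| < 1 / 2 := hz.trans_le (min_le_right _ _)
  have h0 : 0 < ‖z‖ := by linarith [(abs_lt.1 h2).1]
  refine hUp (hsub (mem_thickening_iff.2 ⟨z / (‖z‖ : ℂ), ?_, ?_⟩))
  · simp [h0.ne']
  · have : z - z / (‖z‖ : ℂ) = z / (‖z‖ : ℂ) * ((‖z‖ - 1 : ℝ) : ℂ) := by
      have : (‖z‖ : ℂ) ≠ 0 := by exact_mod_cast h0.ne'
      field_simp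
      push_cast
      ring
    rw [dist_eq_norm, this, norm_mul, Complex.norm_real, norm_div, Complex.norm_real,
      norm_norm, div_self h0.ne', one_mul]
    exact h1

/-- The Cauchy integral of `φ` over the circle of radius `r` about the origin. -/
noncomputable def cauchyTransform (r : ℝ) (φ : ℂ → ℂ) (z : ℂ) : ℂ :=
  (2 * Real.pi * I : ℂ)⁻¹ • ∮ w in C(0, r), (w - z)⁻¹ • φ w

section cauchyTransform

variable {r : ℝ} {φ ψ : ℂ → ℂ}

theorem analyticOnNhd_cauchyTransform (hr : 0 < r) (hφ : ContinuousOn φ (sphere 0 r)) :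
    AnalyticOnNhd ℂ (cauchyTransform r φ) (ball 0 r) := by
  lift r to NNReal using hr.le
  have h := (hasFPowerSeriesOn_cauchy_integral (hφ.circleIntegrable r.2)
    (by exact_mod_cast hr)).analyticOnNhd
  rwa [← NNReal.coe_eq_zero.not.1 hr.ne' |> fun _ => Metric.eball_coe (x := (0 : ℂ)) (ε := r)]

theorem continuousOn_cauchyKernel {z : ℂ} (hz : ‖z‖ < r) (hφ : ContinuousOn φ (sphere 0 r)) :
    ContinuousOn (fun w => (w - z)⁻¹ • φ w) (sphere 0 r) := by
  refine ContinuousOn.smul (f := fun w => (w - z)⁻¹)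
    (ContinuousOn.inv₀ (continuousOn_id.sub continuousOn_const) ?_) hφ
  intro w hw h0
  rw [sub_eq_zero.1 h0] at hw
  simp at hw
  linarith

theorem norm_cauchyTransform_le (hr : 1 < r) {M : ℝ} (hM : ∀ w ∈ sphere (0 : ℂ) r, ‖φ w‖ ≤ M)
    {z : ℂ} (hz : ‖z‖ ≤ 1) : ‖cauchyTransform r φ z‖ ≤ r * ((r - 1)⁻¹ * M) := by
  refine circleIntegral.norm_two_pi_i_inv_smul_integral_le_of_norm_le_const (by linarith) ?_
  intro w hw
  rw [norm_smul, norm_inv]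
  have h1 : r - 1 ≤ ‖w - z‖ := by
    have := norm_sub_norm_le w z
    rw [mem_sphere_zero_iff_norm.1 hw] at this
    linarith
  have : 0 < r - 1 := by linarith
  have := (norm_nonneg _).trans (hM w hw)
  exact mul_le_mul (inv_anti₀ (by assumption) h1) (hM w hw) (norm_nonneg _) (by positivity)

theorem norm_cauchyTransform_sub_le (hr : 1 < r) (hφ : ContinuousOn φ (sphere 0 r)) {M : ℝ}
    (hM : ∀ w ∈ sphere (0 : ℂ) r, ‖φ w‖ ≤ M) {x y : ℂ} (hx : ‖x‖ ≤ 1) (hy : ‖y‖ ≤ 1) :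
    ‖cauchyTransform r φ x - cauchyTransform r φ y‖ ≤
      r * ((r - 1)⁻¹ * (r - 1)⁻¹ * M) * ‖x - y‖ := by
  have hr0 : 0 < r := by linarith
  rw [cauchyTransform, cauchyTransform, ← smul_sub, ← circleIntegral.integral_sub
    ((continuousOn_cauchyKernel (hx.trans_lt hr) hφ).circleIntegrable hr0.le)
    ((continuousOn_cauchyKernel (hy.trans_lt hr) hφ).circleIntegrable hr0.le), mul_assoc r]
  refine circleIntegral.norm_two_pi_i_inv_smul_integral_le_of_norm_le_const hr0.le ?_
  intro w hw
  have h1 : ∀ z : ℂ, ‖z‖ ≤ 1 → r - 1 ≤ ‖w - z‖ := fun z hz => by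
    have := norm_sub_norm_le w z
    rw [mem_sphere_zero_iff_norm.1 hw] at this
    linarith
  have hp : 0 < r - 1 := by linarith
  have hM0 := (norm_nonneg _).trans (hM w hw)
  have hx0 : w - x ≠ 0 := norm_pos_iff.1 (hp.trans_le (h1 x hx))
  have hy0 : w - y ≠ 0 := norm_pos_iff.1 (hp.trans_le (h1 y hy))
  have : (w - x)⁻¹ • φ w - (w - y)⁻¹ • φ w = (w - x)⁻¹ * (w - y)⁻¹ * φ w * (x - y) := by
    simp only [smul_eq_mul]
    field_simp
    ring
  rw [this, norm_mul, norm_mul, norm_mul, norm_inv, norm_inv]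
  have := inv_anti₀ hp (h1 x hx)
  have := inv_anti₀ hp (h1 y hy)
  have := hM w hw
  gcongr

theorem cauchyTransform_add (hr : 0 < r) (hφ : ContinuousOn φ (sphere 0 r))
    (hψ : ContinuousOn ψ (sphere 0 r)) {z : ℂ} (hz : ‖z‖ < r) :
    cauchyTransform r (fun w => φ w + ψ w) z = cauchyTransform r φ z + cauchyTransform r ψ z := by
  rw [cauchyTransform, cauchyTransform, cauchyTransform, ← smul_add, ← circleIntegral.integral_add
    ((continuousOn_cauchyKernel hz hφ).circleIntegrable hr.le)
    ((continuousOn_cauchyKernel hz hψ).circleIntegrable hr.le)]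
  simp only [smul_add]

theorem cauchyTransform_const_mul (c : ℂ) (z : ℂ) :
    cauchyTransform r (fun w => c * φ w) z = c * cauchyTransform r φ z := by
  simp only [cauchyTransform, smul_eq_mul, mul_left_comm _ c]
  rw [circleIntegral.integral_const_mul, mul_left_comm]

theorem cauchyTransform_congr (hr : 0 ≤ r) (h : ∀ w ∈ sphere (0 : ℂ) r, φ w = ψ w) (z : ℂ) :
    cauchyTransform r φ z = cauchyTransform r ψ z := by
  rw [cauchyTransform, cauchyTransform]
  congr 1
  exact circleIntegral.integral_congr hr fun w hw => by simp only [h w hw]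

/-- Cauchy's formula on an annulus. -/
theorem sub_cauchyTransform_eq {r' : ℝ} (hr' : 0 < r')
    (h : AnalyticOnNhd ℂ φ (closedBall 0 r \ ball 0 r')) {z : ℂ} (hz : r' < ‖z‖) (hz' : ‖z‖ < r) :
    φ z - cauchyTransform r φ z = - cauchyTransform r' φ z := by
  have hle : r' ≤ r := by linarith
  have hd := h.dslope z (by simp; constructor <;> linarith)
  have key := Complex.circleIntegral_eq_of_differentiable_on_annulus_off_countable hr' hle
    countable_empty hd.continuousOn (fun w hw => (hd w (by
      have := hw.1
      simp only [Set.mem_sdiff, mem_ball, dist_zero_right, mem_closedBall, not_le, not_lt] at this ⊢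
      exact ⟨this.1.le, this.2.le⟩)).differentiableAt)
  have hs : ∀ ρ, 0 ≤ ρ → r' ≤ ρ → ρ ≤ r → ‖z‖ ≠ ρ → (∮ w in C(0, ρ), dslope φ z w) =
      (∮ w in C(0, ρ), (w - z)⁻¹ • φ w) - (∮ w in C(0, ρ), (w - z)⁻¹) * φ z := by
    intro ρ h0 h1 h2 hne
    have hwz : ∀ w ∈ sphere (0 : ℂ) ρ, w ≠ z := by
      rintro w hw rfl
      exact hne (by simpa using hw)
    have hi : ContinuousOn (fun w => (w - z)⁻¹) (sphere (0 : ℂ) ρ) :=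
      ContinuousOn.inv₀ (by fun_prop) fun w hw => sub_ne_zero.2 (hwz w hw)
    have hφ : ContinuousOn φ (sphere (0 : ℂ) ρ) := h.continuousOn.mono fun w hw => by
      have : ‖w‖ = ρ := by simpa using hw
      simp [this, h1, h2]
    have e1 : (∮ w in C(0, ρ), dslope φ z w) =
        ∮ w in C(0, ρ), ((w - z)⁻¹ • φ w - φ z • (w - z)⁻¹) :=
      circleIntegral.integral_congr h0 fun w hw => by
        simp only [dslope_of_ne _ (hwz w hw), slope_def_field, smul_eq_mul]
        ring
    have := circleIntegral.integral_sub ((hi.smul hφ).circleIntegrable h0)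
      ((hi.const_smul (φ z)).circleIntegrable h0)
    simp only [Pi.smul_apply', Pi.smul_apply, smul_eq_mul] at this ⊢
    simp only [smul_eq_mul] at e1
    rw [e1, this, circleIntegral.integral_const_mul]
    ring
  have h2 : (∮ w in C(0, r'), (w - z)⁻¹) = 0 := by
    refine Complex.circleIntegral_eq_zero_of_differentiable_on_off_countable hr'.le
      countable_empty ?_ ?_
    · refine ContinuousOn.inv₀ (by fun_prop) ?_
      intro w hw h0
      rw [sub_eq_zero.1 h0] at hw
      simp at hw
      linarith
    · intro w hw
      refine DifferentiableAt.inv (by fun_prop) ?_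
      intro h0
      have := hw.1
      rw [sub_eq_zero.1 h0] at this
      simp at this
      linarith
  rw [hs r (by linarith) hle le_rfl hz'.ne, hs r' hr'.le le_rfl hle hz.ne', h2,
    circleIntegral.integral_sub_inv_of_mem_ball (by simpa using hz')] at key
  simp only [cauchyTransform]
  rw [zero_mul, sub_zero, sub_eq_iff_eq_add] at key
  rw [key, smul_add, smul_eq_mul _ (_ * _), ← mul_assoc,
    inv_mul_cancel₀ Complex.two_pi_I_ne_zero]
  ring

/-- The part of a Laurent decomposition that is analytic near infinity, in terms of the conjugate
of a function analytic on the closed disk. -/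
theorem exists_sub_cauchyTransform_eq_conj (hr : 1 < r)
    (h : AnalyticOnNhd ℂ φ {z | 1 ≤ ‖z‖ ∧ ‖z‖ ≤ r}) :
    ∃ V : ℂ → ℂ, AnalyticOnNhd ℂ V (closedBall 0 1) ∧ V 0 = 0 ∧
      ∀ z, ‖z‖ = 1 → φ z - cauchyTransform r φ z = (starRingEnd ℂ) (V z) := by
  obtain ⟨ε, h0, h1, hε⟩ := exists_annulus (p := fun z => AnalyticAt ℂ φ z)
    fun z hz => (h z ⟨hz.ge, by linarith⟩).eventually_analyticAt
  set r' := 1 - ε / 2 with hr'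
  have hr0 : 0 < r' := by linarith
  have hr1 : r' < 1 := by linarith
  have hφ : AnalyticOnNhd ℂ φ (closedBall 0 r \ ball 0 r') := by
    intro z hz
    simp only [Set.mem_sdiff, mem_closedBall, dist_zero_right, mem_ball, not_lt] at hz
    by_cases hz1 : 1 ≤ ‖z‖
    · exact h z ⟨hz1, hz.1⟩
    · refine hε z ?_
      rw [abs_lt]
      constructor <;> linarith [hz.2]
  have hφc : ContinuousOn φ (sphere 0 r') := hφ.continuousOn.mono fun w hw => by
    have : ‖w‖ = r' := by simpa using hw
    simp [this]; linarith
  have hsc : ∀ v ∈ sphere (0 : ℂ) r'⁻¹, ((starRingEnd ℂ) v)⁻¹ ∈ sphere (0 : ℂ) r' := by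
    intro v hv
    have : ‖v‖ = r'⁻¹ := by simpa using hv
    simp [this]
  have hne : ∀ v ∈ sphere (0 : ℂ) r'⁻¹, v ≠ 0 := by
    rintro v hv rfl
    simp [hr0.ne] at hv
  set φs : ℂ → ℂ := fun v => (starRingEnd ℂ) (φ ((starRingEnd ℂ) v)⁻¹) / v with hφs
  have hφsc : ContinuousOn φs (sphere 0 r'⁻¹) := by
    refine ContinuousOn.div ?_ continuousOn_id hne
    refine Complex.continuous_conj.comp_continuousOn (hφc.comp ?_ hsc)
    exact ContinuousOn.inv₀ Complex.continuous_conj.continuousOn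
      fun v hv => by simpa using hne v hv
  have hA := analyticOnNhd_cauchyTransform (inv_pos.2 hr0) hφsc
  have hlt : 1 < r'⁻¹ := one_lt_inv_iff₀.2 ⟨hr0, hr1⟩
  refine ⟨fun z => z * cauchyTransform r'⁻¹ φs z, ?_, by simp, ?_⟩
  · exact analyticOnNhd_id.mul (hA.mono (closedBall_subset_ball hlt))
  intro z hz
  rw [sub_cauchyTransform_eq hr0 hφ (by linarith) (by linarith), neg_eq_iff_eq_neg, ← map_neg]
  have hz0 : z ≠ 0 := by rintro rfl; simp at hz
  have hconj : (starRingEnd ℂ) z = z⁻¹ := by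
    rw [Complex.inv_def, Complex.normSq_eq_norm_sq, hz]; simp
  have hcm : ∀ θ : ℝ, (starRingEnd ℂ) (circleMap 0 r'⁻¹ θ) = (circleMap 0 r' θ)⁻¹ := by
    intro θ
    simp [circleMap, ← Complex.exp_conj, ← Complex.exp_neg, mul_comm]
  have hu : ∀ θ : ℝ, circleMap 0 r' θ ≠ 0 := fun θ => by simp [hr0.ne']
  have huz : ∀ θ : ℝ, circleMap 0 r' θ - z ≠ 0 := fun θ h0 => by
    have := norm_circleMap_zero r' θ
    rw [sub_eq_zero.1 h0, hz, abs_of_pos hr0] at this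
    linarith
  simp only [cauchyTransform, circleIntegral, smul_eq_mul, map_neg, map_mul]
  rw [intervalIntegral.integral_of_le Real.two_pi_pos.le,
    intervalIntegral.integral_of_le Real.two_pi_pos.le, ← integral_conj, hconj]
  have : ∀ θ : ℝ, (starRingEnd ℂ) (deriv (circleMap 0 r'⁻¹) θ *
      ((circleMap 0 r'⁻¹ θ - z)⁻¹ * φs (circleMap 0 r'⁻¹ θ))) =
      z * (deriv (circleMap 0 r') θ * ((circleMap 0 r' θ - z)⁻¹ * φ (circleMap 0 r' θ))) := by
    intro θ
    simp only [hφs, deriv_circleMap, map_mul, map_inv₀, map_sub, map_div₀, hcm, hconj, conj_conj,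
      conj_I, inv_inv]
    have h1 := hu θ
    have h2 := huz θ
    have h3 : z - circleMap 0 r' θ ≠ 0 := by rw [← neg_sub]; exact neg_ne_zero.2 h2
    have h4 : (circleMap 0 r' θ)⁻¹ - z⁻¹ = (z - circleMap 0 r' θ) / (circleMap 0 r' θ * z) := by
      field_simp
    rw [h4]
    field_simp
    ring
  simp only [this]
  rw [MeasureTheory.integral_const_mul]
  simp only [map_inv₀, map_mul, conj_I, conj_ofReal, map_ofNat]
  field_simp

end cauchyTransform

theorem exists_boundedContinuousFunction {φ : ℂ → ℂ} (hφ : ContinuousOn φ (closedBall 0 1)) :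
    ∃ u : BoundedContinuousFunction (closedBall (0 : ℂ) 1) ℂ, ∀ z, u z = φ z := by
  have : CompactSpace (closedBall (0 : ℂ) 1) :=
    isCompact_iff_compactSpace.1 (isCompact_closedBall 0 1)
  exact ⟨BoundedContinuousFunction.mkOfCompact ⟨_, hφ.domRestrict⟩, fun z => rfl⟩

theorem continuousOn_extend (g : BoundedContinuousFunction (closedBall (0 : ℂ) 1) ℂ) :
    ContinuousOn (Function.extend Subtype.val g 0) (closedBall 0 1) := by
  rw [continuousOn_iff_continuous_domRestrict]
  convert g.continuous using 1
  ext z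
  exact Subtype.val_injective.extend_apply _ _ z

/-- The operator `g ↦ P₊ (g ∘ p)`, realised as a Cauchy integral over a larger circle. -/
theorem exists_compact_cauchyTransform {r : ℝ} (hr : 1 < r) {p : ℂ → ℂ}
    (hp : ContinuousOn p (sphere 0 r)) (hpm : MapsTo p (sphere 0 r) (closedBall 0 1)) :
    ∃ K : BoundedContinuousFunction (closedBall (0 : ℂ) 1) ℂ →L[ℂ]
        BoundedContinuousFunction (closedBall (0 : ℂ) 1) ℂ,
      IsCompactOperator K ∧
      ∀ g z, K g z = cauchyTransform r (fun w => Function.extend Subtype.val g 0 (p w)) z := by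
  have : CompactSpace (closedBall (0 : ℂ) 1) :=
    isCompact_iff_compactSpace.1 (isCompact_closedBall 0 1)
  have hr0 : 0 < r := by linarith
  have hval : ∀ (g : BoundedContinuousFunction (closedBall (0 : ℂ) 1) ℂ) {x : ℂ}
      (hx : x ∈ closedBall (0 : ℂ) 1), Function.extend Subtype.val g 0 x = g ⟨x, hx⟩ :=
    fun g x hx => Subtype.val_injective.extend_apply g 0 ⟨x, hx⟩
  have hcont : ∀ g : BoundedContinuousFunction (closedBall (0 : ℂ) 1) ℂ,
      ContinuousOn (fun w => Function.extend Subtype.val g 0 (p w)) (sphere 0 r) :=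
    fun g => (continuousOn_extend g).comp hp hpm
  have hz1 : ∀ z : closedBall (0 : ℂ) 1, ‖(z : ℂ)‖ ≤ 1 := fun z => mem_closedBall_zero_iff.1 z.2
  have hbd : ∀ (g : BoundedContinuousFunction (closedBall (0 : ℂ) 1) ℂ), ∀ w ∈ sphere (0 : ℂ) r,
      ‖Function.extend Subtype.val g 0 (p w)‖ ≤ ‖g‖ := fun g w hw => by
    rw [hval g (hpm hw)]
    exact g.norm_coe_le_norm _
  choose K₀ hK₀ using fun g => exists_boundedContinuousFunction
    ((analyticOnNhd_cauchyTransform hr0 (hcont g)).continuousOn.mono (closedBall_subset_ball hr))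
  let L : BoundedContinuousFunction (closedBall (0 : ℂ) 1) ℂ →ₗ[ℂ]
      BoundedContinuousFunction (closedBall (0 : ℂ) 1) ℂ :=
    { toFun := K₀
      map_add' := fun f g => by
        ext z
        rw [BoundedContinuousFunction.add_apply, hK₀, hK₀, hK₀,
          ← cauchyTransform_add hr0 (hcont f) (hcont g) ((hz1 z).trans_lt hr)]
        refine cauchyTransform_congr hr0.le (fun w hw => ?_) _
        rw [hval _ (hpm hw), hval _ (hpm hw), hval _ (hpm hw), BoundedContinuousFunction.add_apply]
      map_smul' := fun c g => by
        ext z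
        rw [RingHom.id_apply, BoundedContinuousFunction.smul_apply, hK₀, hK₀, smul_eq_mul,
          ← cauchyTransform_const_mul]
        refine cauchyTransform_congr hr0.le (fun w hw => ?_) _
        rw [hval _ (hpm hw), hval _ (hpm hw), BoundedContinuousFunction.smul_apply, smul_eq_mul] }
  have hpos : 0 < r * (r - 1)⁻¹ := mul_pos hr0 (inv_pos.2 (by linarith))
  have hL : ∀ g, ‖L g‖ ≤ r * (r - 1)⁻¹ * ‖g‖ := fun g => by
    refine (BoundedContinuousFunction.norm_le (by positivity)).2 fun z => ?_
    rw [show L g z = _ from hK₀ g z, mul_assoc]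
    exact norm_cauchyTransform_le hr (hbd g) (hz1 z)
  refine ⟨L.mkContinuous _ hL, ?_, hK₀⟩
  refine (isCompactOperator_iff_isCompact_closure_image_closedBall
    (L.mkContinuous _ hL).toLinearMap one_pos).2 ?_
  refine BoundedContinuousFunction.arzela_ascoli (closedBall (0 : ℂ) (r * (r - 1)⁻¹))
    (isCompact_closedBall _ _) _ ?_ ?_
  · rintro _ z ⟨g, hg, rfl⟩
    have hg1 : ‖g‖ ≤ 1 := by simpa using hg
    rw [mem_closedBall_zero_iff]
    calc ‖L g z‖ ≤ ‖L g‖ := (L g).norm_coe_le_norm z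
      _ ≤ _ := hL g
      _ ≤ _ := by nlinarith
  · refine Metric.equicontinuous_of_continuity_modulus
      (fun d => r * ((r - 1)⁻¹ * (r - 1)⁻¹ * 1) * d) ?_ _ ?_
    · exact Continuous.tendsto' (by fun_prop) _ _ (by simp)
    · rintro x y ⟨_, g, hg, rfl⟩
      have hg1 : ‖g‖ ≤ 1 := by simpa using hg
      rw [dist_eq_norm]
      change ‖K₀ g x - K₀ g y‖ ≤ _
      rw [hK₀, hK₀, Subtype.dist_eq, dist_eq_norm]
      exact norm_cauchyTransform_sub_le hr (hcont g) (fun w hw => (hbd g w hw).trans hg1)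
        (hz1 x) (hz1 y)

namespace Weld

variable {s t : ℂ → ℂ} {S T : ℝ → ℝ}

theorem sub_eq_of_cauchyTransform (W : Weld s t S T) {r : ℝ} (hr : 1 < r) {f g h : ℂ → ℂ} {c : ℂ}
    (hl : AnalyticOnNhd ℂ (fun w => g (s w) + h w) {z | 1 ≤ ‖z‖ ∧ ‖z‖ ≤ r})
    (hrt : AnalyticOnNhd ℂ (fun w => f (t w) - h (t w)) {z | 1 ≤ ‖z‖ ∧ ‖z‖ ≤ r})
    (hf : ∀ z, ‖z‖ = 1 → f z = cauchyTransform r (fun w => g (s w) + h w) z)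
    (hg : ∀ z, ‖z‖ = 1 → g z + c = cauchyTransform r (fun w => f (t w) - h (t w)) z) :
    c = 0 ∧ ∀ z, ‖z‖ = 1 → f z - g (s z) = h z := by
  obtain ⟨V, hV, hV0, hVe⟩ := exists_sub_cauchyTransform_eq_conj hr hl
  obtain ⟨U, hU, hU0, hUe⟩ := exists_sub_cauchyTransform_eq_conj hr hrt
  obtain ⟨d, hd⟩ := W.symm.liouville (F := fun z => -U z - (starRingEnd ℂ) c) (G := V)
    (hU.neg.sub analyticOnNhd_const) hV (fun z hz => by
      apply (starRingEnd ℂ).injective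
      have h1 := hVe _ (W.symm.norm_eq_one hz)
      have h2 := hUe _ hz
      rw [← hf _ (W.symm.norm_eq_one hz), W.symm.left_inverse hz] at h1
      rw [← hg _ hz] at h2
      rw [← h1, map_sub, map_neg, ← h2, conj_conj]
      ring)
  have hd0 : d = 0 := by rw [← (hd 0 (by simp)).2, hV0]
  refine ⟨?_, fun z hz => ?_⟩
  · have := (hd 0 (by simp)).1
    simpa [hU0, hd0] using this
  · have := hVe z hz
    rw [(hd z hz.le).2, hd0, ← hf z hz, map_zero] at this
    linear_combination -this

theorem exists_solution (W : Weld s t S T) {h : ℂ → ℂ}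
    (hh : AnalyticOnNhd ℂ h (sphere 0 1)) :
    ∃ F G : ℂ → ℂ, AnalyticOnNhd ℂ F (closedBall 0 1) ∧ AnalyticOnNhd ℂ G (closedBall 0 1) ∧
      ∀ z, ‖z‖ = 1 → F z - G (s z) = h z := by
  obtain ⟨ε, hε0, hε1, hε⟩ := exists_annulus (p := fun w => AnalyticAt ℂ s w ∧ AnalyticAt ℂ t w ∧
      AnalyticAt ℂ h w ∧ AnalyticAt ℂ (fun z => h (t z)) w ∧ (1 < ‖w‖ → ‖s w‖ < 1) ∧
      (1 < ‖w‖ → ‖t w‖ < 1)) (by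
    intro z hz
    have hzs : z ∈ sphere (0 : ℂ) 1 := by simpa using hz
    have htz : t z ∈ sphere (0 : ℂ) 1 := by simpa using W.symm.norm_eq_one hz
    filter_upwards [(W.left.an z hzs).eventually_analyticAt,
      (W.right.an z hzs).eventually_analyticAt, (hh z hzs).eventually_analyticAt,
      ((hh _ htz).fun_comp (W.right.an z hzs)).eventually_analyticAt,
      W.left.flip z hz, W.right.flip z hz] with w h1 h2 h3 h4 h5 h6
    exact ⟨h1, h2, h3, h4, h5, h6⟩)
  set r := 1 + ε / 2 with hrdef
  have hr : 1 < r := by linarith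
  have hr0 : 0 < r := by linarith
  have hA : ∀ w : ℂ, 1 ≤ ‖w‖ ∧ ‖w‖ ≤ r → |‖w‖ - 1| < ε := fun w hw => by
    rw [abs_lt]; constructor <;> linarith [hw.1, hw.2]
  have hsr : ∀ w ∈ sphere (0 : ℂ) r, 1 ≤ ‖w‖ ∧ ‖w‖ ≤ r := fun w hw => by
    have : ‖w‖ = r := by simpa using hw
    exact ⟨by linarith, this.le⟩
  have mapS : ∀ w : ℂ, 1 ≤ ‖w‖ ∧ ‖w‖ ≤ r → ‖s w‖ ≤ 1 := fun w hw => by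
    rcases hw.1.eq_or_lt with h1 | h1
    · exact (W.norm_eq_one h1.symm).le
    · exact ((hε w (hA w hw)).2.2.2.2.1 h1).le
  have mapT : ∀ w : ℂ, 1 ≤ ‖w‖ ∧ ‖w‖ ≤ r → ‖t w‖ ≤ 1 := fun w hw => by
    rcases hw.1.eq_or_lt with h1 | h1
    · exact (W.symm.norm_eq_one h1.symm).le
    · exact ((hε w (hA w hw)).2.2.2.2.2 h1).le
  have cS : ContinuousOn s (sphere 0 r) := fun w hw =>
    (hε w (hA w (hsr w hw))).1.continuousAt.continuousWithinAt
  have cT : ContinuousOn t (sphere 0 r) := fun w hw =>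
    (hε w (hA w (hsr w hw))).2.1.continuousAt.continuousWithinAt
  have mS : MapsTo s (sphere 0 r) (closedBall 0 1) := fun w hw => by
    simpa using mapS w (hsr w hw)
  have mT : MapsTo t (sphere 0 r) (closedBall 0 1) := fun w hw => by
    simpa using mapT w (hsr w hw)
  obtain ⟨K, -, hK⟩ := exists_compact_cauchyTransform hr cS mS
  obtain ⟨K', hK'c, hK'⟩ := exists_compact_cauchyTransform hr cT mT
  let o : closedBall (0 : ℂ) 1 := ⟨0, by simp⟩
  -- the equation for `g` alone determines a solution
  have core : ∀ (η : ℂ → ℂ), (∀ w, 1 ≤ ‖w‖ ∧ ‖w‖ ≤ r → AnalyticAt ℂ η w) →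
      (∀ w, 1 ≤ ‖w‖ ∧ ‖w‖ ≤ r → AnalyticAt ℂ (fun z => η (t z)) w) →
      ∀ g u v : BoundedContinuousFunction (closedBall (0 : ℂ) 1) ℂ,
      (∀ z, u z = cauchyTransform r η z) →
      (∀ z, v z = cauchyTransform r (fun w => -η (t w)) z) →
      (∀ z, g z + g o = K' (K g + u) z + v z) →
      ∃ F G : ℂ → ℂ, AnalyticOnNhd ℂ F (closedBall 0 1) ∧ AnalyticOnNhd ℂ G (closedBall 0 1) ∧
        (∀ z, g z = G z) ∧ g o = 0 ∧ ∀ z, ‖z‖ = 1 → F z - G (s z) = η z := by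
    intro η hη hηt g u v hu hv hg
    have cη : ContinuousOn η (sphere 0 r) := fun w hw =>
      (hη w (hsr w hw)).continuousAt.continuousWithinAt
    have cηt : ContinuousOn (fun w => η (t w)) (sphere 0 r) := fun w hw =>
      (hηt w (hsr w hw)).continuousAt.continuousWithinAt
    have cg : ContinuousOn (fun w => Function.extend Subtype.val g 0 (s w)) (sphere 0 r) :=
      (continuousOn_extend g).comp cS mS
    set f : ℂ → ℂ := cauchyTransform r
      (fun w => Function.extend Subtype.val g 0 (s w) + η w) with hf
    have hfa : AnalyticOnNhd ℂ f (closedBall 0 1) :=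
      (analyticOnNhd_cauchyTransform hr0 (cg.add cη)).mono (closedBall_subset_ball hr)
    have cft : ContinuousOn (fun w => f (t w)) (sphere 0 r) := hfa.continuousOn.comp cT mT
    set G : ℂ → ℂ := fun z => cauchyTransform r (fun w => f (t w) - η (t w)) z - g o with hG
    have hGa : AnalyticOnNhd ℂ G (closedBall 0 1) :=
      ((analyticOnNhd_cauchyTransform hr0 (cft.sub cηt)).sub analyticOnNhd_const).mono
        (closedBall_subset_ball hr)
    have hfz : ∀ z : closedBall (0 : ℂ) 1, (K g + u) z = f z := fun z => by
      rw [BoundedContinuousFunction.add_apply, hK, hu, hf, cauchyTransform_add hr0 cg cη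
        ((mem_closedBall_zero_iff.1 z.2).trans_lt hr)]
    have hgG : ∀ z, g z = G z := fun z => by
      rw [hG, eq_sub_iff_add_eq, hg, hK', hv, ← cauchyTransform_add hr0
        (φ := fun w => Function.extend Subtype.val (K g + u) 0 (t w))
        ((continuousOn_extend _).comp cT mT) cηt.fun_neg ((mem_closedBall_zero_iff.1 z.2).trans_lt hr)]
      refine cauchyTransform_congr hr0.le (fun w hw => ?_) _
      rw [Subtype.val_injective.extend_apply _ _ (⟨t w, mT hw⟩ : closedBall (0 : ℂ) 1), hfz,
        sub_eq_add_neg]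
    have hext : ∀ w ∈ sphere (0 : ℂ) r, Function.extend Subtype.val g 0 (s w) = G (s w) :=
      fun w hw => by
        rw [Subtype.val_injective.extend_apply _ _ (⟨s w, mS hw⟩ : closedBall (0 : ℂ) 1), hgG]
    obtain ⟨h1, h2⟩ := W.sub_eq_of_cauchyTransform hr (f := f) (g := G) (h := η) (c := g o)
      (fun w hw => AnalyticAt.add ((hGa _ (by simpa using mapS w hw)).fun_comp (hε w (hA w hw)).1)
        (hη w hw))
      (fun w hw => AnalyticAt.sub ((hfa _ (by simpa using mapT w hw)).fun_comp (hε w (hA w hw)).2.1)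
        (hηt w hw))
      (fun z hz => by
        rw [hf]
        exact cauchyTransform_congr hr0.le (fun w hw => by rw [hext w hw]) _)
      (fun z hz => by simp only [hG, sub_add_cancel])
    exact ⟨f, G, hfa, hGa, hgG, h1, h2⟩
  let ev := BoundedContinuousFunction.evalCLM (β := ℂ) ℂ o
  let Q := K' ∘L K - ev.smulRight (1 : BoundedContinuousFunction (closedBall (0 : ℂ) 1) ℂ)
  have hQ : ∀ g z, Q g z = K' (K g) z - g o := fun g z => by
    simp [Q, ev]
  have hQc : IsCompactOperator Q := by
    refine IsCompactOperator.sub (f := K' ∘ K) (hK'c.comp_clm K) ?_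
    exact (isCompactOperator_of_locallyCompactSpace_dom ev).clm_comp
      (ContinuousLinearMap.toSpanSingleton ℂ (1 : BoundedContinuousFunction _ ℂ))
  rcases hQc.hasEigenvalue_or_mem_resolventSet one_ne_zero with hev | hres
  · exfalso
    obtain ⟨g, hg⟩ := hev.exists_hasEigenvector
    refine hg.2 ?_
    have hgQ : Q g = g := by simpa using hg.apply_eq_smul
    obtain ⟨F, G, hF, hG, hgG, hg0, hFG⟩ := core (fun _ => 0) (fun _ _ => analyticAt_const)
      (fun _ _ => analyticAt_const) g 0 0 (by simp [cauchyTransform, circleIntegral]) (by simp [cauchyTransform, circleIntegral])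
      (fun z => by
        have := hQ g z
        rw [hgQ] at this
        simp [this])
    obtain ⟨c, hc⟩ := W.liouville hF hG (fun z hz => sub_eq_zero.1 (hFG z hz))
    have hGc : ∀ z, g z = c := fun z => by
      rw [hgG, (hc z (mem_closedBall_zero_iff.1 z.2)).2]
    ext z
    rw [hGc z, ← hGc o, hg0]
    rfl
  · have hhA : ∀ w, 1 ≤ ‖w‖ ∧ ‖w‖ ≤ r → AnalyticAt ℂ h w := fun w hw => (hε w (hA w hw)).2.2.1
    have hhtA : ∀ w, 1 ≤ ‖w‖ ∧ ‖w‖ ≤ r → AnalyticAt ℂ (fun z => h (t z)) w :=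
      fun w hw => (hε w (hA w hw)).2.2.2.1
    obtain ⟨u, hu⟩ := exists_boundedContinuousFunction ((analyticOnNhd_cauchyTransform hr0
      (φ := h) fun w hw => (hhA w (hsr w hw)).continuousAt.continuousWithinAt).continuousOn.mono
        (closedBall_subset_ball hr))
    obtain ⟨v, hv⟩ := exists_boundedContinuousFunction ((analyticOnNhd_cauchyTransform hr0
      (φ := fun w => -h (t w))
      fun w hw => (hhtA w (hsr w hw)).neg.continuousAt.continuousWithinAt).continuousOn.mono
        (closedBall_subset_ball hr))
    have hunit := spectrum.mem_resolventSet_iff.1 hres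
    obtain ⟨g, hg⟩ : ∃ g, g - Q g = K' u + v := by
      obtain ⟨R, hR⟩ := hunit.exists_right_inv
      refine ⟨R (K' u + v), ?_⟩
      have := congrArg (fun L => L (K' u + v)) hR
      simpa using this
    obtain ⟨F, G, hF, hG, -, -, hFG⟩ := core h hhA hhtA g u v hu hv (fun z => by
      have := congrArg (fun e => e z) hg
      simp only [BoundedContinuousFunction.sub_apply, BoundedContinuousFunction.add_apply,
        hQ] at this
      rw [map_add, BoundedContinuousFunction.add_apply]
      linear_combination this)
    exact ⟨F, G, hF, hG, hFG⟩

end Weld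

namespace Weld

variable {s t : ℂ → ℂ} {S T : ℝ → ℝ}

theorem exists_pole_right (W : Weld s t S T) :
    ∃ F G : ℂ → ℂ, AnalyticOnNhd ℂ F (closedBall 0 1) ∧ AnalyticOnNhd ℂ G (closedBall 0 1) ∧
      ∀ z, ‖z‖ = 1 → F z = 1 / s z + G (s z) := by
  obtain ⟨F, G, hF, hG, h⟩ := W.exists_solution (h := fun z => 1 / s z) (fun z hz => by
    have := W.left.an z hz
    have h0 := W.ne_zero (z := z) (by simpa using hz)
    fun_prop (disch := assumption))
  exact ⟨F, G, hF, hG, fun z hz => by rw [← h z hz]; ring⟩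

theorem exists_pole_left (W : Weld s t S T) {p : ℂ} (hp : ‖p‖ < 1) :
    ∃ H K : ℂ → ℂ, AnalyticOnNhd ℂ H (closedBall 0 1) ∧ AnalyticOnNhd ℂ K (closedBall 0 1) ∧
      ∀ z, ‖z‖ = 1 → 1 / (z - p) + H z = K (s z) := by
  obtain ⟨F, G, hF, hG, h⟩ := W.exists_solution (h := fun z => -(1 / (z - p))) (fun z hz => by
    have h0 : z - p ≠ 0 := fun h => by
      rw [sub_eq_zero] at h; subst h; simp at hz; linarith
    fun_prop (disch := assumption))
  refine ⟨F, G, hF, hG, fun z hz => ?_⟩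
  have := h z hz
  linear_combination this

theorem dslope_left_ne_zero (W : Weld s t S T) {F G : ℂ → ℂ} (hF : AnalyticOnNhd ℂ F (closedBall 0 1))
    (hG : AnalyticOnNhd ℂ G (closedBall 0 1)) (hFG : ∀ z, ‖z‖ = 1 → F z = 1 / s z + G (s z))
    {p : ℂ} (hp : ‖p‖ < 1) {z : ℂ} (hz : ‖z‖ ≤ 1) :
    dslope F p z ≠ 0 := by
  obtain ⟨H, K, hH, hK, hHK⟩ := W.exists_pole_left hp
  obtain ⟨β, hβ, h⟩ := W.exists_relation hF hG hH hK hp hFG hHK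
  intro h0
  exact hβ (by rw [← (h z hz).1, h0, zero_mul])

theorem left_ne_right (W : Weld s t S T) {F G : ℂ → ℂ} (hF : AnalyticOnNhd ℂ F (closedBall 0 1))
    (hG : AnalyticOnNhd ℂ G (closedBall 0 1)) (hFG : ∀ z, ‖z‖ = 1 → F z = 1 / s z + G (s z))
    {p : ℂ} (hp : ‖p‖ < 1) {ζ : ℂ} (hζ : ‖ζ‖ ≤ 1) :
    1 + ζ * G ζ - ζ * F p ≠ 0 := by
  obtain ⟨H, K, hH, hK, hHK⟩ := W.exists_pole_left hp
  obtain ⟨β, hβ, h⟩ := W.exists_relation hF hG hH hK hp hFG hHK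
  intro h0
  exact hβ (by rw [← (h ζ hζ).2, h0, zero_mul])

theorem eq_of_left_eq (W : Weld s t S T) {F G : ℂ → ℂ} (hF : AnalyticOnNhd ℂ F (closedBall 0 1))
    (hG : AnalyticOnNhd ℂ G (closedBall 0 1)) (hFG : ∀ z, ‖z‖ = 1 → F z = 1 / s z + G (s z))
    {p z : ℂ} (hp : ‖p‖ < 1) (hz : ‖z‖ ≤ 1) (h : F z = F p) : z = p := by
  by_contra hne
  have := W.dslope_left_ne_zero hF hG hFG hp hz
  rw [dslope_of_ne _ hne, slope_def_field, h] at this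
  simp at this

theorem injOn_left (W : Weld s t S T) {F G : ℂ → ℂ} (hF : AnalyticOnNhd ℂ F (closedBall 0 1))
    (hG : AnalyticOnNhd ℂ G (closedBall 0 1)) (hFG : ∀ z, ‖z‖ = 1 → F z = 1 / s z + G (s z)) : InjOn F (closedBall 0 1) := by
  intro p hp q hq hpq
  have hp1 : ‖p‖ ≤ 1 := by simpa using hp
  have hq1 : ‖q‖ ≤ 1 := by simpa using hq
  rcases hp1.lt_or_eq with hp2 | hp2
  · exact (W.eq_of_left_eq hF hG hFG hp2 hq1 hpq.symm).symm
  rcases hq1.lt_or_eq with hq2 | hq2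
  · exact W.eq_of_left_eq hF hG hFG hq2 hp1 hpq
  by_contra hne
  obtain ⟨U, V, hU, hV, hpU, hqV, hUV⟩ := t2_separation hne
  have hev : F =ᶠ[𝓝 q] fun z => 1 / s z + G (s z) := by
    refine eventuallyEq_of_eq_on_circle hq2 (hF q hq) ?_ (Eventually.of_forall hFG)
    have h1 := W.left.an q (by simp [hq2])
    have h0 := W.ne_zero hq2
    have h2 : AnalyticAt ℂ (fun z => G (s z)) q :=
      AnalyticAt.comp (hG _ (by simp [W.norm_eq_one hq2])) h1
    exact (analyticAt_const.div h1 h0).add h2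
  have hs0 : ∀ᶠ z in 𝓝 q, s z ≠ 0 :=
    (W.left.an q (by simp [hq2])).continuousAt.eventually_ne (W.ne_zero hq2)
  have hnear := hev.and (hs0.and ((W.left.flip q hq2).and (hV.mem_nhds hqV)))
  have hopen := (hF q hq).eventually_constant_or_nhds_le_map_nhds
  rcases hopen with hc | hopen
  · have hFc : EqOn F (fun _ => F q) (closedBall 0 1) :=
      hF.eqOn_of_preconnected_of_eventuallyEq analyticOnNhd_const
        (convex_closedBall _ _).isPreconnected hq hc
    exact hne (by
      have h0 := W.eq_of_left_eq hF hG hFG (p := 0) (by simp) hp1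
        ((hFc hp).trans (hFc (by simp)).symm)
      rw [h0] at hp2; simp at hp2)
  · have himg : F '' {z | F z = 1 / s z + G (s z) ∧ s z ≠ 0 ∧ (1 < ‖z‖ → ‖s z‖ < 1) ∧ z ∈ V}
        ∈ 𝓝 (F p) := by
      rw [hpq]
      exact hopen (image_mem_map hnear)
    have hpre := (hF p hp).continuousAt.preimage_mem_nhds himg
    have hcl : p ∈ closure (ball (0 : ℂ) 1) := by
      rw [closure_ball _ one_ne_zero]; exact hp
    obtain ⟨p', ⟨hp'1, hp'U⟩, hp'2⟩ := mem_closure_iff_nhds.1 hcl _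
      (inter_mem hpre (hU.mem_nhds hpU))
    obtain ⟨q', ⟨e1, e2, e3, e4⟩, e5⟩ := hp'1
    have hp'3 : ‖p'‖ < 1 := by simpa using hp'2
    rcases le_or_gt ‖q'‖ 1 with h1 | h1
    · have := W.eq_of_left_eq hF hG hFG hp'3 h1 e5
      subst this
      exact (Set.disjoint_left.1 hUV hp'U) e4
    · refine W.left_ne_right hF hG hFG hp'3 (e3 h1).le ?_
      rw [← e5, e1]; field_simp; ring

theorem eq_of_right_eq (W : Weld s t S T) {F G : ℂ → ℂ} (hF : AnalyticOnNhd ℂ F (closedBall 0 1))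
    (hG : AnalyticOnNhd ℂ G (closedBall 0 1)) (hFG : ∀ z, ‖z‖ = 1 → F z = 1 / s z + G (s z))
    {ζ q : ℂ} (hζ : ‖ζ‖ ≤ 1) (hq : ‖q‖ ≤ 1) (hζ0 : ζ ≠ 0) (hq0 : q ≠ 0)
    (h : 1 / ζ + G ζ = 1 / q + G q) : ζ = q := by
  obtain ⟨H, K, hH, hK, hHK⟩ := W.exists_pole_left (p := 0) (by simp)
  obtain ⟨β, hβ, hrel⟩ := W.exists_relation hF hG hH hK (by simp) hFG hHK
  have hKH : ∀ z, ‖z‖ = 1 → K z = 1 / t z + H (t z) := fun z hz => by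
    have := hHK _ (W.symm.norm_eq_one hz)
    rw [W.symm.left_inverse hz] at this
    simpa using this.symm
  have e2 : ∀ z, z * dslope K 0 z = K z - K 0 := fun z => by
    simpa using sub_smul_dslope K 0 z
  refine W.symm.injOn_left hK hH hKH (by simpa using hζ) (by simpa using hq) ?_
  have key : ∀ z, ‖z‖ ≤ 1 → z ≠ 0 → (1 / z + G z - F 0) * (K z - K 0) = β := fun z hz hz0 => by
    rw [← (hrel z hz).2, ← e2]; field_simp
  have h1 := key ζ hζ hζ0
  have h2 := key q hq hq0
  rw [h] at h1
  have h3 : 1 / q + G q - F 0 ≠ 0 := fun h0 => hβ (by rw [← h2, h0, zero_mul])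
  have := mul_left_cancel₀ h3 (h1.trans h2.symm)
  simpa using this

theorem dslope_right_ne_zero (W : Weld s t S T) {F G : ℂ → ℂ} (hF : AnalyticOnNhd ℂ F (closedBall 0 1))
    (hG : AnalyticOnNhd ℂ G (closedBall 0 1)) (hFG : ∀ z, ‖z‖ = 1 → F z = 1 / s z + G (s z))
    {q ζ : ℂ} (hq : ‖q‖ < 1) (hq0 : q ≠ 0) (hζ : ‖ζ‖ ≤ 1) :
    dslope (fun z => 1 + z * G z - z * (1 / q + G q)) q ζ ≠ 0 := by
  rcases eq_or_ne ζ q with rfl | hne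
  · rw [dslope_same]
    obtain ⟨H, K, hH, hK, hHK⟩ := W.exists_pole_left (p := 0) (by simp)
    obtain ⟨β, hβ, hrel⟩ := W.exists_relation hF hG hH hK (by simp) hFG hHK
    have hKH : ∀ z, ‖z‖ = 1 → K z = 1 / t z + H (t z) := fun z hz => by
      have := hHK _ (W.symm.norm_eq_one hz)
      rw [W.symm.left_inverse hz] at this
      simpa using this.symm
    have e2 : ∀ z, z * dslope K 0 z = K z - K 0 := fun z => by
      simpa using sub_smul_dslope K 0 z
    have key : ∀ z, ‖z‖ ≤ 1 → (1 + z * G z - z * F 0) * (K z - K 0) = β * z := fun z hz => by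
      rw [← (hrel z hz).2, ← e2]; ring
    have hK' := W.symm.dslope_left_ne_zero hK hH hKH hq hζ
    rw [dslope_same] at hK'
    have hζc : ζ ∈ closedBall (0 : ℂ) 1 := by simpa using hζ
    have dG := (hG ζ hζc).differentiableAt.hasDerivAt
    have dK := (hK ζ hζc).differentiableAt.hasDerivAt
    have d1 : HasDerivAt (fun z => 1 + z * G z - z * F 0)
        (1 * G ζ + ζ * deriv G ζ - 1 * F 0) ζ :=
      (((hasDerivAt_id' ζ).mul dG).const_add 1).sub ((hasDerivAt_id' ζ).mul_const _)
    have d2 := d1.mul (dK.sub_const (K 0))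
    have d3 : HasDerivAt (fun z => β * z) (β * 1) ζ := (hasDerivAt_id' ζ).const_mul β
    have heq : (fun z => (1 + z * G z - z * F 0) * (K z - K 0)) =ᶠ[𝓝 ζ] fun z => β * z := by
      filter_upwards [isOpen_ball.mem_nhds (show ζ ∈ ball (0 : ℂ) 1 by simpa using hq)] with z hz
      exact key z (by simpa using (mem_ball.1 hz).le)
    have d4 := d2.unique (d3.congr_of_eventuallyEq heq)
    have d5 : HasDerivAt (fun z => 1 + z * G z - z * (1 / ζ + G ζ))
        (1 * G ζ + ζ * deriv G ζ - 1 * (1 / ζ + G ζ)) ζ :=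
      (((hasDerivAt_id' ζ).mul dG).const_add 1).sub ((hasDerivAt_id' ζ).mul_const _)
    rw [d5.deriv]
    intro h0
    have h1 := key ζ hζ
    have h2 := W.left_ne_right hF hG hFG (p := 0) (by simp) hζ
    have h3 : (1 + ζ * G ζ - ζ * F 0) * deriv K ζ = 0 := by
      have h4 : ζ * deriv G ζ = 1 / ζ := by linear_combination h0
      have h5 : (1 * G ζ + ζ * deriv G ζ - 1 * F 0) * ζ = 1 + ζ * G ζ - ζ * F 0 := by
        rw [h4]; field_simp; ring
      apply mul_left_cancel₀ hq0
      linear_combination ζ * d4 - h1 - (K ζ - K 0) * h5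
    exact (mul_ne_zero h2 hK') h3
  · rw [dslope_of_ne _ hne, slope_def_field]
    refine div_ne_zero ?_ (sub_ne_zero.2 hne)
    have hv : 1 + q * G q - q * (1 / q + G q) = 0 := by field_simp; ring
    rw [hv, sub_zero]
    rcases eq_or_ne ζ 0 with rfl | h0
    · simp
    intro h
    apply hne
    refine W.eq_of_right_eq hF hG hFG hζ hq.le h0 hq0 ?_
    field_simp
    field_simp at h
    linear_combination h

end Weld

/-- The finite Blaschke product with constant `c` and zeros `a i`. -/
noncomputable def blaschke {n : ℕ} (c : ℂ) (a : Fin n → ℂ) (z : ℂ) : ℂ :=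
  c * ∏ i, (z - a i) / (1 - (starRingEnd ℂ) (a i) * z)

theorem blaschke_denom_ne_zero {a z : ℂ} (ha : ‖a‖ < 1) (hz : ‖z‖ ≤ 1) :
    1 - (starRingEnd ℂ) a * z ≠ 0 := by
  intro h
  have h1 : ‖(starRingEnd ℂ) a * z‖ = 1 := by rw [← sub_eq_zero.1 h, norm_one]
  rw [norm_mul, RCLike.norm_conj] at h1
  nlinarith [norm_nonneg a, norm_nonneg z]

theorem norm_blaschke_denom_sq_sub (a z : ℂ) :
    ‖1 - (starRingEnd ℂ) a * z‖ ^ 2 - ‖z - a‖ ^ 2 = (1 - ‖a‖ ^ 2) * (1 - ‖z‖ ^ 2) := by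
  simp only [← Complex.normSq_eq_norm_sq, Complex.normSq_apply, sub_re, sub_im, mul_re, mul_im,
    conj_re, conj_im, one_re, one_im]
  ring

theorem norm_blaschke_factor_lt_one {a z : ℂ} (ha : ‖a‖ < 1) (hz : ‖z‖ < 1) :
    ‖(z - a) / (1 - (starRingEnd ℂ) a * z)‖ < 1 := by
  have h0 := norm_pos_iff.2 (blaschke_denom_ne_zero ha hz.le)
  rw [norm_div, div_lt_one h0]
  refine lt_of_pow_lt_pow_left₀ 2 h0.le ?_
  have h := norm_blaschke_denom_sq_sub a z
  have : 0 < (1 - ‖a‖ ^ 2) * (1 - ‖z‖ ^ 2) :=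
    mul_pos (by nlinarith [norm_nonneg a]) (by nlinarith [norm_nonneg z])
  linarith

theorem norm_blaschke_factor_eq_one {a z : ℂ} (ha : ‖a‖ < 1) (hz : ‖z‖ = 1) :
    ‖(z - a) / (1 - (starRingEnd ℂ) a * z)‖ = 1 := by
  have h0 := norm_pos_iff.2 (blaschke_denom_ne_zero ha hz.le)
  rw [norm_div, div_eq_one_iff_eq h0.ne']
  have h := norm_blaschke_denom_sq_sub a z
  rw [hz] at h
  refine (pow_left_inj₀ (norm_nonneg _) (norm_nonneg _) two_ne_zero).1 ?_
  linarith

theorem one_lt_norm_blaschke_factor {a z : ℂ} (ha : ‖a‖ < 1) (hz : 1 < ‖z‖)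
    (h0 : 1 - (starRingEnd ℂ) a * z ≠ 0) : 1 < ‖(z - a) / (1 - (starRingEnd ℂ) a * z)‖ := by
  rw [norm_div, one_lt_div (norm_pos_iff.2 h0)]
  refine lt_of_pow_lt_pow_left₀ 2 (norm_nonneg _) ?_
  have h := norm_blaschke_denom_sq_sub a z
  have : 0 < (1 - ‖a‖ ^ 2) * (‖z‖ ^ 2 - 1) :=
    mul_pos (by nlinarith [norm_nonneg a]) (by nlinarith [norm_nonneg z])
  linarith

section blaschke

variable {n : ℕ} {c : ℂ} {a : Fin n → ℂ}

theorem norm_blaschke_eq_one (hc : ‖c‖ = 1) (ha : ∀ i, ‖a i‖ < 1) {z : ℂ} (hz : ‖z‖ = 1) :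
    ‖blaschke c a z‖ = 1 := by
  rw [blaschke, norm_mul, hc, one_mul, norm_prod]
  exact Finset.prod_eq_one fun i _ => norm_blaschke_factor_eq_one (ha i) hz

theorem norm_blaschke_lt_one (hn : 1 ≤ n) (hc : ‖c‖ = 1) (ha : ∀ i, ‖a i‖ < 1) {z : ℂ}
    (hz : ‖z‖ < 1) : ‖blaschke c a z‖ < 1 := by
  rw [blaschke, norm_mul, hc, one_mul, norm_prod]
  have h := fun i => norm_blaschke_factor_lt_one (ha i) hz
  have hi : (⟨0, hn⟩ : Fin n) ∈ Finset.univ := Finset.mem_univ _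
  rw [← Finset.mul_prod_erase _ _ hi]
  refine mul_lt_one_of_nonneg_of_lt_one_left (norm_nonneg _) (h _) ?_
  exact Finset.prod_le_one (fun i _ => norm_nonneg _) fun i _ => (h i).le

theorem one_lt_norm_blaschke (hn : 1 ≤ n) (hc : ‖c‖ = 1) (ha : ∀ i, ‖a i‖ < 1) {z : ℂ}
    (hz : 1 < ‖z‖) (hd : ∀ i, 1 - (starRingEnd ℂ) (a i) * z ≠ 0) : 1 < ‖blaschke c a z‖ := by
  rw [blaschke, norm_mul, hc, one_mul, norm_prod]
  have h := fun i => one_lt_norm_blaschke_factor (ha i) hz (hd i)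
  have hi : (⟨0, hn⟩ : Fin n) ∈ Finset.univ := Finset.mem_univ _
  rw [← Finset.mul_prod_erase _ _ hi]
  exact one_lt_mul_of_lt_of_le (h _) (Finset.one_le_prod fun i _ => (h i).le)

theorem eventually_blaschke_denom_ne_zero (ha : ∀ i, ‖a i‖ < 1) {z : ℂ} (hz : ‖z‖ ≤ 1) :
    ∀ᶠ w in 𝓝 z, ∀ i, 1 - (starRingEnd ℂ) (a i) * w ≠ 0 := by
  rw [eventually_all]
  intro i
  have : ContinuousAt (fun w => 1 - (starRingEnd ℂ) (a i) * w) z := by fun_prop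
  exact this.eventually_ne (blaschke_denom_ne_zero (ha i) hz)

theorem analyticOnNhd_blaschke (ha : ∀ i, ‖a i‖ < 1) :
    AnalyticOnNhd ℂ (blaschke c a) (closedBall 0 1) := by
  intro z hz
  refine analyticAt_const.mul (Finset.analyticAt_fun_prod _ fun i _ => ?_)
  have := blaschke_denom_ne_zero (ha i) (by simpa using hz)
  fun_prop (disch := assumption)

theorem blaschke_factor_sum_pos {a z : ℂ} (ha : ‖a‖ < 1) (hz : ‖z‖ = 1) :
    z * logDeriv (fun w => (w - a) / (1 - (starRingEnd ℂ) a * w)) z =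
      (((1 - ‖a‖ ^ 2) / ‖z - a‖ ^ 2 : ℝ) : ℂ) := by
  have h0 := blaschke_denom_ne_zero ha hz.le
  have h1 : z - a ≠ 0 := fun h => by
    rw [sub_eq_zero.1 h] at hz; linarith
  rw [logDeriv_div z h1 h0 (by fun_prop) (by fun_prop)]
  have d1 : deriv (fun w => w - a) z = 1 := by simp
  have d2 : deriv (fun w => 1 - (starRingEnd ℂ) a * w) z = -(starRingEnd ℂ) a := by
    rw [deriv_const_sub, deriv_const_mul _ differentiableAt_id, deriv_id'']
    simp
  rw [logDeriv_apply, logDeriv_apply, d1, d2]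
  have hzz : z * (starRingEnd ℂ) z = 1 := by
    rw [Complex.mul_conj, Complex.normSq_eq_norm_sq, hz]; simp
  push_cast
  rw [← Complex.mul_conj', ← Complex.mul_conj', map_sub]
  have h2 : (starRingEnd ℂ) z - (starRingEnd ℂ) a ≠ 0 := by
    rw [← map_sub]; exact (_root_.map_ne_zero _).2 h1
  have h3 : 1 - (starRingEnd ℂ) a * z = z * ((starRingEnd ℂ) z - (starRingEnd ℂ) a) := by
    linear_combination -hzz
  have hz0 : z ≠ 0 := by rintro rfl; simp at hz
  rw [h3]
  field_simp
  linear_combination hzz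

theorem deriv_blaschke_ne_zero (hn : 1 ≤ n) (hc : ‖c‖ = 1) (ha : ∀ i, ‖a i‖ < 1) {z : ℂ}
    (hz : ‖z‖ = 1) : deriv (blaschke c a) z ≠ 0 := by
  intro hd
  have hc0 : c ≠ 0 := by rintro rfl; simp at hc
  have hne : ∀ i ∈ Finset.univ, (z - a i) / (1 - (starRingEnd ℂ) (a i) * z) ≠ 0 := fun i _ => by
    rw [← norm_pos_iff, norm_blaschke_factor_eq_one (ha i) hz]; exact one_pos
  have hl : logDeriv (blaschke c a) z = 0 := by rw [logDeriv_apply, hd, zero_div]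
  have he : blaschke c a = fun w => c * ∏ i, (w - a i) / (1 - (starRingEnd ℂ) (a i) * w) := rfl
  rw [he, logDeriv_const_mul _ _ hc0, logDeriv_prod hne (fun i _ => by
    have := blaschke_denom_ne_zero (ha i) hz.le
    fun_prop (disch := assumption))] at hl
  have := congrArg (fun x => (z * x).re) hl
  simp only [Finset.mul_sum, blaschke_factor_sum_pos (ha _) hz, ← Complex.ofReal_sum,
    Complex.ofReal_re, mul_zero, Complex.zero_re] at this
  refine (Finset.sum_pos (fun i _ => ?_) ⟨⟨0, hn⟩, Finset.mem_univ _⟩).ne' this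
  have h1 : z - a i ≠ 0 := fun h => by
    have := ha i
    rw [← sub_eq_zero.1 h] at this; linarith
  have := norm_pos_iff.2 h1
  have : 0 < 1 - ‖a i‖ ^ 2 := by nlinarith [ha i, norm_nonneg (a i)]
  positivity

theorem blaschke_conj_mul (hc : ‖c‖ = 1) (ha : ∀ i, ‖a i‖ < 1) {z : ℂ} (hz : ‖z‖ = 1) :
    blaschke ((starRingEnd ℂ) c) (fun i => (starRingEnd ℂ) (a i)) z⁻¹ * blaschke c a z = 1 := by
  have hcc : (starRingEnd ℂ) c * c = 1 := by
    rw [mul_comm, Complex.mul_conj, Complex.normSq_eq_norm_sq, hc]; simp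
  have hz0 : z ≠ 0 := by rintro rfl; simp at hz
  rw [blaschke, blaschke, mul_mul_mul_comm, hcc, one_mul, ← Finset.prod_mul_distrib]
  refine Finset.prod_eq_one fun i _ => ?_
  have h0 := blaschke_denom_ne_zero (ha i) hz.le
  have h1 : z - a i ≠ 0 := fun h => by
    have := ha i
    rw [← sub_eq_zero.1 h] at this; linarith
  have h2 : 1 - a i * z⁻¹ = (z - a i) * z⁻¹ := by field_simp
  have h3 : z⁻¹ - (starRingEnd ℂ) (a i) = (1 - (starRingEnd ℂ) (a i) * z) * z⁻¹ := by field_simp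
  rw [conj_conj, h2, h3]
  field_simp

end blaschke

/-- Local analytic continuations of a function on the circle glue together. -/
theorem exists_analytic_extension {σ : ℂ → ℂ}
    (h : ∀ q, ‖q‖ = 1 → ∃ f, AnalyticAt ℂ f q ∧ ∀ᶠ z in 𝓝 q, ‖z‖ = 1 → f z = σ z) :
    ∃ s, AnalyticOnNhd ℂ s (sphere 0 1) ∧ ∀ z, ‖z‖ = 1 → s z = σ z := by
  have h' : ∀ q : sphere (0 : ℂ) 1, ∃ f : ℂ → ℂ, ∃ ρ > 0, ∀ z ∈ ball (q : ℂ) ρ,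
      AnalyticAt ℂ f z ∧ (‖z‖ = 1 → f z = σ z) := fun q => by
    obtain ⟨f, hf, he⟩ := h q (by simp)
    obtain ⟨ρ, hρ, hb⟩ := Metric.eventually_nhds_iff_ball.1 (hf.eventually_analyticAt.and he)
    exact ⟨f, ρ, hρ, hb⟩
  choose f ρ hρ hf using h'
  obtain ⟨δ, hδ, hleb⟩ := lebesgue_number_lemma_of_metric (isCompact_sphere (0 : ℂ) 1)
    (c := fun q : sphere (0 : ℂ) 1 => ball (q : ℂ) (ρ q)) (fun _ => isOpen_ball)
    (fun q hq => mem_iUnion.2 ⟨⟨q, hq⟩, mem_ball_self (hρ _)⟩)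
  have h2 : ∀ p : ℂ, ∃ g : ℂ → ℂ, ‖p‖ = 1 → ∀ z ∈ ball p δ,
      AnalyticAt ℂ g z ∧ (‖z‖ = 1 → g z = σ z) := fun p => by
    by_cases hp : ‖p‖ = 1
    · obtain ⟨q, hq⟩ := hleb p (by simpa using hp)
      exact ⟨f q, fun _ z hz => hf q z (hq hz)⟩
    · exact ⟨0, fun h => (hp h).elim⟩
  choose g hg using h2
  refine ⟨fun z => g (z / ‖z‖) z, ?_, ?_⟩
  · intro q hq
    have hq1 : ‖q‖ = 1 := by simpa using hq
    refine ((hg q hq1 q (mem_ball_self hδ)).1).congr ?_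
    filter_upwards [Metric.ball_mem_nhds q (show 0 < min (δ / 4) 1 by positivity)] with z hz
    have hzq : ‖z - q‖ < min (δ / 4) 1 := by rwa [← dist_eq_norm]
    have hz4 := hzq.trans_le (min_le_left _ _)
    have hz1 := hzq.trans_le (min_le_right _ _)
    have hab : |‖z‖ - 1| ≤ ‖z - q‖ := by rw [← hq1]; exact abs_norm_sub_norm_le z q
    have hz0 : 0 < ‖z‖ := by linarith [(abs_le.1 hab).1]
    have hzc : (‖z‖ : ℂ) ≠ 0 := by exact_mod_cast hz0.ne'
    set p := z / (‖z‖ : ℂ) with hp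
    have hp1 : ‖p‖ = 1 := by simp [hp, hz0.ne']
    have hzp : ‖z - p‖ ≤ ‖z - q‖ := by
      have : z - p = p * ((‖z‖ - 1 : ℝ) : ℂ) := by
        rw [hp]
        field_simp
        push_cast
        ring
      rw [this, norm_mul, hp1, one_mul, Complex.norm_real]
      exact hab
    have hpq : ‖p - q‖ < δ := by
      calc ‖p - q‖ = ‖(z - q) - (z - p)‖ := by ring_nf
        _ ≤ ‖z - q‖ + ‖z - p‖ := norm_sub_le _ _
        _ < δ := by linarith
    have hcv : Convex ℝ (ball q δ ∩ ball p δ) := (convex_ball q δ).inter (convex_ball p δ)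
    have hp_mem : p ∈ ball q δ ∩ ball p δ := ⟨by rwa [mem_ball, dist_eq_norm], mem_ball_self hδ⟩
    refine AnalyticOnNhd.eqOn_of_preconnected_of_eventuallyEq (f := g q) (g := g p)
      (fun w hw => (hg q hq1 w hw.1).1) (fun w hw => (hg p hp1 w hw.2).1)
      hcv.isPreconnected hp_mem ?_ ⟨?_, ?_⟩
    · refine eventuallyEq_of_eq_on_circle hp1 (hg q hq1 p hp_mem.1).1 (hg p hp1 p hp_mem.2).1 ?_
      filter_upwards [(isOpen_ball.inter isOpen_ball).mem_nhds hp_mem] with w hw hw1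
      rw [(hg q hq1 w hw.1).2 hw1, (hg p hp1 w hw.2).2 hw1]
    · rw [mem_ball, dist_eq_norm]; linarith
    · rw [mem_ball, dist_eq_norm]; linarith
  · intro z hz
    simp only [hz, ofReal_one, div_one]
    exact (hg z hz z (mem_ball_self hδ)).2 hz

theorem exp_ofReal_mul_I_periodic_comp {S : ℝ → ℝ}
    (hper : ∀ θ, S (θ + 2 * Real.pi) = S θ - 2 * Real.pi) :
    Function.Periodic (fun θ : ℝ => Complex.exp (S θ * I)) (2 * Real.pi) := by
  intro θ
  simp only [hper]
  push_cast
  rw [sub_mul, Complex.exp_periodic.sub_eq]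

theorem exp_lift_arg {S : ℝ → ℝ} (hper : ∀ θ, S (θ + 2 * Real.pi) = S θ - 2 * Real.pi) (θ : ℝ) :
    Complex.exp (S (Complex.arg (Complex.exp (θ * I))) * I) = Complex.exp (S θ * I) := by
  rw [Complex.arg_exp_mul_I, toIocMod]
  exact (exp_ofReal_mul_I_periodic_comp hper).sub_zsmul_eq _

theorem exists_circleFlip {n : ℕ} (hn : 1 ≤ n) {c c' : ℂ} {a b : Fin n → ℂ} (hc : ‖c‖ = 1)
    (hc' : ‖c'‖ = 1) (ha : ∀ i, ‖a i‖ < 1) (hb : ∀ i, ‖b i‖ < 1) {S : ℝ → ℝ}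
    (hcont : Continuous S) (hanti : StrictAnti S)
    (hper : ∀ θ, S (θ + 2 * Real.pi) = S θ - 2 * Real.pi)
    (hS : ∀ θ : ℝ, blaschke c a (Complex.exp (S θ * I)) * blaschke c' b (Complex.exp (θ * I)) = 1) :
    ∃ s, CircleFlip s S := by
  set σ : ℂ → ℂ := fun z => Complex.exp (S (Complex.arg z) * I) with hσ
  have hσ1 : ∀ z, ‖σ z‖ = 1 := fun z => Complex.norm_exp_ofReal_mul_I _
  have hσl : ∀ θ : ℝ, σ (Complex.exp (θ * I)) = Complex.exp (S θ * I) := exp_lift_arg hper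
  have hrel : ∀ z, ‖z‖ = 1 → blaschke c a (σ z) * blaschke c' b z = 1 := fun z hz => by
    obtain ⟨θ, rfl⟩ := exists_exp_of_norm_eq_one hz
    rw [hσl, hS]
  have hσc : ∀ q, ‖q‖ = 1 → ∃ τ : ℂ → ℂ, ContinuousAt τ q ∧ τ q = σ q ∧
      ∀ z, ‖z‖ = 1 → τ z = σ z := fun q hq => by
    obtain ⟨θ₀, rfl⟩ := exists_exp_of_norm_eq_one hq
    have key : ∀ z, ‖z‖ = 1 → Complex.exp (S (θ₀ + Complex.arg (z / Complex.exp (θ₀ * I))) * I)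
        = σ z := fun z hz => by
      rw [← hσl]
      congr 1
      have h1 : ‖z / Complex.exp (θ₀ * I)‖ = 1 := by rw [norm_div, hz, hq, div_one]
      have h2 := Complex.norm_mul_exp_arg_mul_I (z / Complex.exp (θ₀ * I))
      rw [h1, ofReal_one, one_mul] at h2
      rw [ofReal_add, add_mul, Complex.exp_add, h2, mul_div_cancel₀ _ (Complex.exp_ne_zero _)]
    refine ⟨_, ?_, key _ hq, key⟩
    have h3 : ContinuousAt (fun z => Complex.arg (z / Complex.exp (θ₀ * I)))
        (Complex.exp (θ₀ * I)) := by
      refine ContinuousAt.comp (g := Complex.arg) (Complex.continuousAt_arg ?_) (by fun_prop)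
      rw [div_self (Complex.exp_ne_zero _)]
      exact Complex.one_mem_slitPlane
    have h4 : Continuous fun x : ℝ => Complex.exp (S (θ₀ + x) * I) := by fun_prop
    exact h4.continuousAt.comp h3
  have hC : ∀ z, ‖z‖ = 1 → AnalyticAt ℂ (blaschke c a) z := fun z hz =>
    analyticOnNhd_blaschke ha z (by simp [hz])
  have hB : ∀ z, ‖z‖ = 1 → AnalyticAt ℂ (blaschke c' b) z := fun z hz =>
    analyticOnNhd_blaschke hb z (by simp [hz])
  have hB0 : ∀ z, ‖z‖ = 1 → blaschke c' b z ≠ 0 := fun z hz =>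
    right_ne_zero_of_mul_eq_one (hrel z hz)
  obtain ⟨s, hs, hsσ⟩ := exists_analytic_extension (σ := σ) fun q hq => by
    obtain ⟨g, hg, hl⟩ : ∃ g, AnalyticAt ℂ g (blaschke c a (σ q)) ∧
        ∀ᶠ x in 𝓝 (σ q), g (blaschke c a x) = x := by
      have hCq := hC _ (hσ1 q)
      have hd := deriv_blaschke_ne_zero hn hc ha (hσ1 q)
      exact ⟨_, hCq.analyticAt_localInverse hd,
        HasStrictDerivAt.eventually_left_inverse hCq.hasStrictDerivAt hd⟩
    refine ⟨fun z => g (blaschke c' b z)⁻¹, ?_, ?_⟩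
    · rw [eq_inv_of_mul_eq_one_left (hrel q hq)] at hg
      exact AnalyticAt.fun_comp (f := fun z => (blaschke c' b z)⁻¹) hg
        ((hB q hq).fun_inv (hB0 q hq))
    · obtain ⟨τ, hτc, hτq, hτ⟩ := hσc q hq
      rw [← hτq] at hl
      filter_upwards [hτc.eventually hl] with z hz hz1
      rw [hτ z hz1, eq_inv_of_mul_eq_one_left (hrel z hz1)] at hz
      exact hz
  refine ⟨s, hcont, hanti, hper, fun θ => ?_, hs, fun q hq => ?_⟩
  · rw [hsσ _ (Complex.norm_exp_ofReal_mul_I θ), hσl]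
  · have hsq := hs q (by simpa using hq)
    have hsq1 : ‖s q‖ = 1 := by rw [hsσ q hq, hσ1]
    have he : (fun z => blaschke c a (s z) * blaschke c' b z) =ᶠ[𝓝 q] fun _ => 1 := by
      refine eventuallyEq_of_eq_on_circle hq (((hC _ hsq1).fun_comp hsq).mul (hB q hq))
        analyticAt_const (Eventually.of_forall fun z hz => ?_)
      rw [hsσ z hz, hrel z hz]
    filter_upwards [he, eventually_blaschke_denom_ne_zero hb hq.le,
      hsq.continuousAt.eventually (eventually_blaschke_denom_ne_zero ha hsq1.le)] with z hz hbz haz h1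
    by_contra! hcon
    have hB1 := one_lt_norm_blaschke hn hc' hb h1 hbz
    have hC1 : 1 ≤ ‖blaschke c a (s z)‖ := by
      rcases hcon.eq_or_lt with h | h
      · exact (norm_blaschke_eq_one hc ha h.symm).ge
      · exact (one_lt_norm_blaschke hn hc ha h haz).le
    have := congrArg norm hz
    rw [norm_mul, norm_one] at this
    nlinarith

theorem exists_weld {n : ℕ} (hn : 1 ≤ n) {c c' : ℂ} {a b : Fin n → ℂ} (hc : ‖c‖ = 1)
    (hc' : ‖c'‖ = 1) (ha : ∀ i, ‖a i‖ < 1) (hb : ∀ i, ‖b i‖ < 1) {K : ℝ → ℝ}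
    (hcont : Continuous K) (hmono : StrictMono K)
    (hper : ∀ θ, K (θ + 2 * Real.pi) = K θ + 2 * Real.pi)
    (hK : ∀ θ : ℝ, blaschke c a (Complex.exp (K θ * I)) = blaschke c' b (Complex.exp (θ * I))) :
    ∃ s t T, Weld s t (fun θ => -K θ) T := by
  have hpern : ∀ m : ℕ, K (m * (2 * Real.pi)) = K 0 + m * (2 * Real.pi) := fun m => by
    induction m with
    | zero => simp
    | succ m ih =>
      push_cast
      rw [add_mul, one_mul, hper, ih]; ring
  have hpern' : ∀ m : ℕ, K (-(m * (2 * Real.pi))) = K 0 - m * (2 * Real.pi) := fun m => by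
    induction m with
    | zero => simp
    | succ m ih =>
      have := hper (-((m + 1 : ℕ) * (2 * Real.pi)))
      have h2 : -((m + 1 : ℕ) * (2 * Real.pi)) + 2 * Real.pi = -(m * (2 * Real.pi)) := by
        push_cast; ring
      rw [h2, ih] at this
      push_cast at this ⊢
      linarith
  have hsurj : Function.Surjective K := fun y => by
    obtain ⟨m, hm⟩ := exists_nat_ge (|y - K 0|)
    have hm2 : |y - K 0| ≤ m * (2 * Real.pi) := by
      nlinarith [Real.pi_gt_three, (Nat.cast_nonneg m : (0 : ℝ) ≤ m)]
    have := abs_le.1 hm2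
    refine mem_range_of_exists_le_of_exists_ge hcont ⟨-(m * (2 * Real.pi)), ?_⟩
      ⟨m * (2 * Real.pi), ?_⟩
    · rw [hpern']; linarith
    · rw [hpern]; linarith
  set e := (hmono.orderIsoOfSurjective K hsurj) with he
  have heK : ∀ x, e x = K x := fun x => rfl
  have hca : ∀ i, ‖(starRingEnd ℂ) (a i)‖ < 1 := fun i => by simpa using ha i
  have hneg : ∀ x : ℝ, Complex.exp (((-x : ℝ) : ℂ) * I) = (Complex.exp (x * I))⁻¹ := fun x => by
    rw [← Complex.exp_neg]; push_cast; rw [neg_mul]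
  obtain ⟨s, hs⟩ := exists_circleFlip hn (c := (starRingEnd ℂ) c) (c' := c')
    (a := fun i => (starRingEnd ℂ) (a i)) (b := b) (S := fun θ => -K θ) (by simpa using hc) hc' hca
    hb hcont.neg hmono.neg (fun θ => by rw [hper]; ring) (fun θ => by
      rw [hneg, ← hK]
      exact blaschke_conj_mul hc ha (Complex.norm_exp_ofReal_mul_I _))
  have heper : ∀ y, e.symm (y - 2 * Real.pi) = e.symm y - 2 * Real.pi := fun y => by
    rw [OrderIso.symm_apply_eq, heK]
    have h1 := hper (e.symm y - 2 * Real.pi)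
    rw [sub_add_cancel] at h1
    have h2 : K (e.symm y) = y := e.apply_symm_apply y
    linarith
  obtain ⟨t, ht⟩ := exists_circleFlip hn (c := c') (c' := (starRingEnd ℂ) c) (a := b)
    (b := fun i => (starRingEnd ℂ) (a i)) (S := fun θ => e.symm (-θ)) hc' (by simpa using hc)
    hb hca (e.symm.continuous.comp continuous_neg) (fun x y h => e.symm.strictMono (neg_lt_neg h))
    (fun θ => by rw [← heper]; ring_nf) (fun θ => by
      have h1 : K (e.symm (-θ)) = -θ := e.apply_symm_apply (-θ)
      have h2 := hneg (-θ)
      rw [neg_neg] at h2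
      rw [← hK, h1, h2, mul_comm]
      exact blaschke_conj_mul hc ha (Complex.norm_exp_ofReal_mul_I _))
  refine ⟨s, t, _, hs, ht, fun θ => ?_, fun θ => ?_⟩
  · simp only [neg_neg]; exact e.symm_apply_apply θ
  · show -(e (e.symm (-θ))) = θ
    simp

namespace Weld

variable {s t : ℂ → ℂ} {S T : ℝ → ℝ} {F G : ℂ → ℂ}

theorem right_eq_left (W : Weld s t S T) (hFG : ∀ z, ‖z‖ = 1 → F z = 1 / s z + G (s z)) {ζ : ℂ}
    (hζ : ‖ζ‖ = 1) : 1 / ζ + G ζ = F (t ζ) := by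
  rw [hFG _ (W.symm.norm_eq_one hζ), W.symm.left_inverse hζ]

theorem left_sub_right_ne_zero (W : Weld s t S T) (hF : AnalyticOnNhd ℂ F (closedBall 0 1))
    (hG : AnalyticOnNhd ℂ G (closedBall 0 1)) (hFG : ∀ z, ‖z‖ = 1 → F z = 1 / s z + G (s z))
    {z q : ℂ} (hz : ‖z‖ ≤ 1) (hq : ‖q‖ < 1) (hq0 : q ≠ 0) : F z - (1 / q + G q) ≠ 0 := by
  intro h
  rcases hz.lt_or_eq with h1 | h1
  · refine W.left_ne_right hF hG hFG h1 hq.le ?_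
    rw [sub_eq_zero.1 h]
    field_simp
    ring
  · rw [hFG z h1, sub_eq_zero] at h
    have h2 := W.eq_of_right_eq hF hG hFG (W.norm_eq_one h1).le hq.le (W.ne_zero h1) hq0 h
    rw [← h2, W.norm_eq_one h1] at hq
    exact lt_irrefl _ hq

theorem right_sub_left_ne_zero (W : Weld s t S T) (hF : AnalyticOnNhd ℂ F (closedBall 0 1))
    (hG : AnalyticOnNhd ℂ G (closedBall 0 1)) (hFG : ∀ z, ‖z‖ = 1 → F z = 1 / s z + G (s z))
    {p ζ : ℂ} (hp : ‖p‖ < 1) (hζ : ‖ζ‖ ≤ 1) (hζ0 : ζ ≠ 0) : 1 / ζ + G ζ - F p ≠ 0 := by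
  intro h
  refine W.left_ne_right hF hG hFG hp hζ ?_
  rw [← sub_eq_zero.1 h]
  field_simp
  ring

/-- The two images cover the plane. -/
theorem exists_preimage (W : Weld s t S T) (hF : AnalyticOnNhd ℂ F (closedBall 0 1))
    (hG : AnalyticOnNhd ℂ G (closedBall 0 1)) (hFG : ∀ z, ‖z‖ = 1 → F z = 1 / s z + G (s z))
    (w : ℂ) : (∃ z, ‖z‖ ≤ 1 ∧ F z = w) ∨ ∃ ζ, ‖ζ‖ < 1 ∧ ζ ≠ 0 ∧ 1 / ζ + G ζ = w := by
  by_contra! hcon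
  obtain ⟨h1, h2⟩ := hcon
  have hN : ∀ ζ, ‖ζ‖ ≤ 1 → 1 + ζ * G ζ - ζ * w ≠ 0 := fun ζ hζ h => by
    have hζ0 : ζ ≠ 0 := by rintro rfl; simp at h
    have h3 : 1 / ζ + G ζ = w := by
      field_simp
      linear_combination h
    rcases hζ.lt_or_eq with h4 | h4
    · exact h2 ζ h4 hζ0 h3
    · exact h1 _ (W.symm.norm_eq_one h4).le (by rw [← W.right_eq_left hFG h4, h3])
  obtain ⟨c, hc⟩ := W.liouville (F := fun z => 1 / (F z - w))
    (G := fun ζ => ζ / (1 + ζ * G ζ - ζ * w))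
    (fun z hz => by
      have := hF z hz
      have h0 : F z - w ≠ 0 := sub_ne_zero.2 (h1 z (by simpa using hz))
      fun_prop (disch := assumption))
    (fun z hz => by
      have := hG z hz
      have h0 := hN z (by simpa using hz)
      fun_prop (disch := assumption))
    (fun z hz => by
      have hs := W.ne_zero hz
      have h0 := hN _ (W.norm_eq_one hz).le
      have h3 : F z - w = (1 + s z * G (s z) - s z * w) / s z := by
        rw [hFG z hz]
        field_simp
      simp only [h3]
      field_simp)
  have hc0 := (hc 0 (by simp)).2
  simp only [zero_div] at hc0
  have h3 := (hc 0 (by simp)).1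
  rw [← hc0, div_eq_zero_iff, sub_eq_zero] at h3
  exact h3.elim one_ne_zero (h1 0 (by simp))

theorem conformalPair (W : Weld s t S T) (hF : AnalyticOnNhd ℂ F (closedBall 0 1))
    (hG : AnalyticOnNhd ℂ G (closedBall 0 1)) (hFG : ∀ z, ‖z‖ = 1 → F z = 1 / s z + G (s z)) :
    ConformalPair (F '' sphere 0 1) F (fun w => w + G w⁻¹) := by
  have hinv : ∀ w : ℂ, w + G w⁻¹ = 1 / w⁻¹ + G w⁻¹ := fun w => by simp
  have hnorm : ∀ w : ℂ, 1 ≤ ‖w‖ → ‖w⁻¹‖ ≤ 1 := fun w hw => by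
    rw [norm_inv]; exact inv_le_one_of_one_le₀ hw
  have hnorm' : ∀ w : ℂ, 1 < ‖w‖ → ‖w⁻¹‖ < 1 := fun w hw => by
    rw [norm_inv]; exact inv_lt_one_of_one_lt₀ hw
  have hne : ∀ w : ℂ, 1 ≤ ‖w‖ → w ≠ 0 := fun w hw => norm_pos_iff.1 (by linarith)
  have han : ∀ w : ℂ, 1 ≤ ‖w‖ → AnalyticAt ℂ (fun w => w + G w⁻¹) w := fun w hw => by
    have h1 := hG w⁻¹ (by simpa using hnorm w hw)
    exact analyticAt_id.add (AnalyticAt.fun_comp (f := fun w => w⁻¹) h1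
      (analyticAt_id.fun_inv (hne w hw)))
  have hinj := W.injOn_left hF hG hFG
  refine ⟨hF.continuousOn, hinj, fun z hz => ?_, rfl, fun w hw => ?_, fun w hw v hv h => ?_,
    fun w hw => ?_, ?_, ⟨1, one_pos, ?_⟩, ?_, ?_, ?_, ?_⟩
  · exact (hF z (ball_subset_closedBall hz)).differentiableAt.differentiableWithinAt
  · exact (han w hw).continuousAt.continuousWithinAt
  · simp only [hinv] at h
    exact inv_injective (W.eq_of_right_eq hF hG hFG (hnorm w hw) (hnorm v hv)
      (inv_ne_zero (hne w hw)) (inv_ne_zero (hne v hv)) h)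
  · exact (han w (le_of_lt hw)).differentiableAt.differentiableWithinAt
  · ext w
    constructor
    · rintro ⟨v, hv, rfl⟩
      have hv1 : ‖v⁻¹‖ = 1 := by simpa using hv
      exact ⟨t v⁻¹, by simpa using W.symm.norm_eq_one hv1, by
        simp only [hinv]; rw [W.right_eq_left hFG hv1]⟩
    · rintro ⟨z, hz, rfl⟩
      have hz1 : ‖z‖ = 1 := by simpa using hz
      exact ⟨(s z)⁻¹, by simpa using W.norm_eq_one hz1, by
        simp only [hinv]; rw [inv_inv, hFG z hz1]⟩
  · have hi : Tendsto (fun w : ℂ => w⁻¹) (Bornology.cobounded ℂ) (𝓝 0) :=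
      tendsto_inv₀_cobounded
    have hG0 : Tendsto (fun w : ℂ => G w⁻¹) (Bornology.cobounded ℂ) (𝓝 (G 0)) :=
      (hG 0 (by simp)).continuousAt.tendsto.comp hi
    have h1 := (hG0.mul hi).const_add 1
    rw [mul_zero, add_zero] at h1
    rw [ofReal_one]
    refine h1.congr' ?_
    filter_upwards [hasBasis_cobounded_norm.mem_of_mem (i := 1) trivial] with w hw
    have := hne w hw
    field_simp
  · rw [Set.disjoint_left]
    rintro _ ⟨z, hz, rfl⟩ ⟨w, hw, h⟩
    simp only [hinv] at h
    exact W.right_sub_left_ne_zero hF hG hFG (by simpa using hz) (hnorm w (le_of_lt hw))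
      (inv_ne_zero (hne w (le_of_lt hw))) (sub_eq_zero.2 h)
  · rw [Set.disjoint_left]
    rintro _ ⟨z, hz, rfl⟩ ⟨w, hw, h⟩
    have := hinj (sphere_subset_closedBall hw) (ball_subset_closedBall hz) h
    subst this
    simp only [mem_sphere, mem_ball] at hw hz
    linarith
  · rw [Set.disjoint_left]
    rintro _ ⟨w, hw, rfl⟩ ⟨z, hz, h⟩
    simp only [hinv] at h
    exact W.left_sub_right_ne_zero hF hG hFG (by simpa using (mem_sphere.1 hz).le) (hnorm' w hw)
      (inv_ne_zero (hne w (le_of_lt hw))) (sub_eq_zero.2 h)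
  · rw [eq_univ_iff_forall]
    intro w
    rcases W.exists_preimage hF hG hFG w with ⟨z, hz, rfl⟩ | ⟨ζ, hζ, hζ0, rfl⟩
    · left
      rcases hz.lt_or_eq with h | h
      · exact Or.inl ⟨z, by simpa using h, rfl⟩
      · exact Or.inr ⟨z, by simpa using h, rfl⟩
    · right
      refine ⟨ζ⁻¹, ?_, by simp⟩
      rw [mem_ofPred_eq, norm_inv]
      exact (one_lt_inv₀ (norm_pos_iff.2 hζ0)).2 hζ

/-- The polynomials of the lemniscate are conjugated to the Blaschke products by the two
parametrizations. -/
theorem exists_blaschke_relation (W : Weld s t S T) (hF : AnalyticOnNhd ℂ F (closedBall 0 1))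
    (hG : AnalyticOnNhd ℂ G (closedBall 0 1)) (hFG : ∀ z, ‖z‖ = 1 → F z = 1 / s z + G (s z))
    {n : ℕ} {c c' : ℂ} {q b : Fin n → ℂ} (hc : ‖c‖ = 1) (hc' : ‖c'‖ = 1) (hq : ∀ i, ‖q i‖ < 1)
    (hb : ∀ i, ‖b i‖ < 1) (hrel : ∀ z, ‖z‖ = 1 → blaschke c q (s z) * blaschke c' b z = 1) :
    ∃ γ : ℂ, γ ≠ 0 ∧
      (∀ z, ‖z‖ ≤ 1 → ∏ i, (F z - F (b i)) =
        blaschke c' b z * (γ * ∏ i, if q i = 0 then 1 else F z - (1 / q i + G (q i)))) ∧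
      ∀ ζ, ‖ζ‖ ≤ 1 → ζ ≠ 0 → (∏ i, (1 / ζ + G ζ - F (b i))) * blaschke c q ζ =
        γ * ∏ i, if q i = 0 then 1 else 1 / ζ + G ζ - (1 / q i + G (q i)) := by
  have hc0 : c ≠ 0 := by rintro rfl; simp at hc
  have hc'0 : c' ≠ 0 := by rintro rfl; simp at hc'
  set Q : Fin n → ℂ → ℂ := fun i w => if q i = 0 then 1 else w - (1 / q i + G (q i)) with hQ
  set r : Fin n → ℂ → ℂ := fun i ζ => if q i = 0 then 1 else
    dslope (fun z => 1 + z * G z - z * (1 / q i + G (q i))) (q i) ζ with hr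
  have hQ0 : ∀ i z, ‖z‖ ≤ 1 → Q i (F z) ≠ 0 := fun i z hz => by
    simp only [hQ]
    split_ifs with h
    · exact one_ne_zero
    · exact W.left_sub_right_ne_zero hF hG hFG hz (hq i) h
  have hr0 : ∀ i ζ, ‖ζ‖ ≤ 1 → r i ζ ≠ 0 := fun i ζ hζ => by
    simp only [hr]
    split_ifs with h
    · exact one_ne_zero
    · exact W.dslope_right_ne_zero hF hG hFG (hq i) h hζ
  have hQan : ∀ i, AnalyticOnNhd ℂ (fun z => Q i (F z)) (closedBall 0 1) := fun i z hz => by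
    by_cases h : q i = 0
    · simpa only [hQ, h, if_true] using analyticAt_const
    · simpa only [hQ, h, if_false] using (hF z hz).fun_sub analyticAt_const
  have hran : ∀ i, AnalyticOnNhd ℂ (r i) (closedBall 0 1) := fun i => by
    by_cases h : q i = 0
    · simp only [hr, h, if_true]
      exact fun _ _ => analyticAt_const
    · simp only [hr, h, if_false]
      refine AnalyticOnNhd.dslope (fun z hz => ?_) _ (by simpa using (hq i).le)
      have := hG z hz
      fun_prop
  have hrQ : ∀ i ζ, ζ ≠ 0 → r i ζ * (ζ - q i) = ζ * Q i (1 / ζ + G ζ) := fun i ζ hζ => by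
    simp only [hr, hQ]
    split_ifs with h
    · rw [h]; ring
    · have h1 := sub_smul_dslope (fun z => 1 + z * G z - z * (1 / q i + G (q i))) (q i) ζ
      rw [smul_eq_mul] at h1
      rw [mul_comm, h1]
      field_simp
      ring
  have hbd : ∀ i z, ‖z‖ ≤ 1 → 1 - (starRingEnd ℂ) (b i) * z ≠ 0 :=
    fun i z hz => blaschke_denom_ne_zero (hb i) hz
  have hqd : ∀ i z, ‖z‖ ≤ 1 → 1 - (starRingEnd ℂ) (q i) * z ≠ 0 :=
    fun i z hz => blaschke_denom_ne_zero (hq i) hz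
  set D₁ : ℂ → ℂ := fun z =>
    c'⁻¹ * ∏ i, dslope F (b i) z * (1 - (starRingEnd ℂ) (b i) * z) / Q i (F z) with hD₁
  set D₂ : ℂ → ℂ := fun ζ =>
    c * ∏ i, (1 + ζ * G ζ - ζ * F (b i)) / ((1 - (starRingEnd ℂ) (q i) * ζ) * r i ζ) with hD₂
  have hD₁an : AnalyticOnNhd ℂ D₁ (closedBall 0 1) := fun z hz => by
    refine analyticAt_const.mul (Finset.analyticAt_fun_prod _ fun i _ => ?_)
    have h1 := (hF.dslope (b i) (by simpa using (hb i).le)) z hz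
    have h2 := hQan i z hz
    have h3 := hQ0 i z (by simpa using hz)
    have h4 : AnalyticAt ℂ (fun z => 1 - (starRingEnd ℂ) (b i) * z) z := by fun_prop
    exact (h1.mul h4).div h2 h3
  have hD₂an : AnalyticOnNhd ℂ D₂ (closedBall 0 1) := fun z hz => by
    refine analyticAt_const.mul (Finset.analyticAt_fun_prod _ fun i _ => ?_)
    have hz1 : ‖z‖ ≤ 1 := by simpa using hz
    have h1 := hG z hz
    have h2 := hran i z hz
    have h3 := mul_ne_zero (hqd i z hz1) (hr0 i z hz1)
    fun_prop (disch := assumption)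
  have e₁ : ∀ z, ‖z‖ ≤ 1 →
      ∏ i, (F z - F (b i)) = blaschke c' b z * (D₁ z * ∏ i, Q i (F z)) := fun z hz => by
    have : blaschke c' b z * (D₁ z * ∏ i, Q i (F z)) = (c' * c'⁻¹) *
        ∏ i, (z - b i) / (1 - (starRingEnd ℂ) (b i) * z) *
          (dslope F (b i) z * (1 - (starRingEnd ℂ) (b i) * z) / Q i (F z) * Q i (F z)) := by
      simp only [blaschke, hD₁, Finset.prod_mul_distrib]
      ring
    rw [this, mul_inv_cancel₀ hc'0, one_mul]
    refine Finset.prod_congr rfl fun i _ => ?_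
    have h1 := hQ0 i z hz
    have h2 := hbd i z hz
    rw [← sub_smul_dslope F (b i) z, smul_eq_mul, div_mul_cancel₀ _ h1, div_mul_eq_mul_div,
      eq_div_iff h2]
    ring
  have e₂ : ∀ ζ, ‖ζ‖ ≤ 1 → ζ ≠ 0 → (∏ i, (1 / ζ + G ζ - F (b i))) * blaschke c q ζ =
      D₂ ζ * ∏ i, Q i (1 / ζ + G ζ) := fun ζ hζ hζ0 => by
    have h1 : (∏ i, (1 / ζ + G ζ - F (b i))) * blaschke c q ζ =
        c * ∏ i, (1 / ζ + G ζ - F (b i)) * ((ζ - q i) / (1 - (starRingEnd ℂ) (q i) * ζ)) := by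
      simp only [blaschke, Finset.prod_mul_distrib]
      ring
    have h2 : D₂ ζ * ∏ i, Q i (1 / ζ + G ζ) = c * ∏ i, (1 + ζ * G ζ - ζ * F (b i)) /
        ((1 - (starRingEnd ℂ) (q i) * ζ) * r i ζ) * Q i (1 / ζ + G ζ) := by
      simp only [hD₂, Finset.prod_mul_distrib]
      ring
    rw [h1, h2]
    congr 1
    refine Finset.prod_congr rfl fun i _ => ?_
    have h3 := hr0 i ζ hζ
    have h4 := hqd i ζ hζ
    have h5 : Q i (1 / ζ + G ζ) = r i ζ * (ζ - q i) / ζ := by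
      rw [hrQ i ζ hζ0, mul_div_cancel_left₀ _ hζ0]
    rw [h5]
    field_simp
  obtain ⟨γ, hγ⟩ := W.liouville hD₁an hD₂an fun z hz => by
    have h1 := e₁ z hz.le
    have h2 := e₂ _ (W.norm_eq_one hz).le (W.ne_zero hz)
    rw [← hFG z hz, h1] at h2
    have h3 : ∏ i, Q i (F z) ≠ 0 := Finset.prod_ne_zero_iff.2 fun i _ => hQ0 i z hz.le
    refine mul_right_cancel₀ h3 ?_
    rw [← h2]
    linear_combination -(D₁ z * ∏ i, Q i (F z)) * hrel z hz
  refine ⟨γ, ?_, fun z hz => ?_, fun ζ hζ hζ0 => ?_⟩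
  · rw [← (hγ 0 (by simp)).2]
    refine mul_ne_zero hc0 (Finset.prod_ne_zero_iff.2 fun i _ => ?_)
    simpa using hr0 i 0 (by simp)
  · rw [e₁ z hz, (hγ z hz).1]
  · rw [e₂ ζ hζ hζ0, (hγ ζ hζ).2]

end Weld

theorem natDegree_prod_ite_lt {n : ℕ} {q : Fin n → ℂ} (h : ∃ j, q j = 0) (c : Fin n → ℂ) (γ : ℂ) :
    (C γ * ∏ i, if q i = 0 then 1 else (X - C (c i) : ℂ[X])).natDegree < n := by
  obtain ⟨j, hj⟩ := h
  refine (natDegree_C_mul_le _ _).trans_lt ((natDegree_prod_le _ _).trans_lt ?_)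
  have : ∑ i, (if q i = 0 then 1 else (X - C (c i) : ℂ[X])).natDegree < ∑ _i : Fin n, 1 := by
    refine Finset.sum_lt_sum (fun i _ => ?_) ⟨j, Finset.mem_univ j, ?_⟩
    · split_ifs <;> simp
    · simp [hj]
  simpa using this

/-- Converse direction of Younsi's theorem: any orientation-preserving circle
homeomorphism `k` solving `A ∘ k = B` for finite Blaschke products `A`, `B` of
degree `n` with `A(∞) = ∞` is the fingerprint of an analytic connected rational
lemniscate of degree `n`. -/
theorem younsi_converse (n : ℕ) (hn : 1 ≤ n)
    (a b : Fin n → ℂ) (ha : ∀ i, ‖a i‖ < 1) (hb : ∀ i, ‖b i‖ < 1)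
    (ha0 : ∃ j, a j = 0)
    (mu lam : ℂ) (hmu : ‖mu‖ = 1) (hlam : ‖lam‖ = 1)
    (k : ℂ → ℂ) (K : ℝ → ℝ) (hKcont : Continuous K) (hKmono : StrictMono K)
    (hKper : ∀ θ : ℝ, K (θ + 2 * Real.pi) = K θ + 2 * Real.pi)
    (hkK : ∀ θ : ℝ, k (Complex.exp (θ * Complex.I)) = Complex.exp (K θ * Complex.I))
    (hfun : ∀ z : ℂ, ‖z‖ = 1 →
      mu * ∏ i, (k z - a i) / (1 - (starRingEnd ℂ) (a i) * k z)
        = lam * ∏ i, (z - b i) / (1 - (starRingEnd ℂ) (b i) * z)) :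
    ∃ (P₁ P₂ : ℂ[X]) (φm φp : ℂ → ℂ),
      IsCoprime P₁ P₂ ∧ P₁.natDegree = n ∧ P₂.natDegree < n ∧
      ConformalPair {z : ℂ | ‖P₁.eval z‖ = ‖P₂.eval z‖} φm φp ∧
      ∀ z : ℂ, ‖z‖ = 1 → φp (k z) = φm z := by
  have hAB : ∀ z, ‖z‖ = 1 → blaschke mu a (k z) = blaschke lam b z := hfun
  obtain ⟨s, t, T, W⟩ := exists_weld hn hmu hlam ha hb hKcont hKmono hKper fun θ => by
    rw [← hkK, hAB _ (Complex.norm_exp_ofReal_mul_I θ)]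
  obtain ⟨F, G, hF, hG, hFG⟩ := W.exists_pole_right
  have hk1 : ∀ z, ‖z‖ = 1 → ‖k z‖ = 1 := fun z hz => by
    obtain ⟨θ, rfl⟩ := exists_exp_of_norm_eq_one hz
    rw [hkK, Complex.norm_exp_ofReal_mul_I]
  have hsk : ∀ z, ‖z‖ = 1 → s z = (k z)⁻¹ := fun z hz => by
    obtain ⟨θ, rfl⟩ := exists_exp_of_norm_eq_one hz
    rw [W.left.lift, hkK, ← Complex.exp_neg]
    push_cast
    rw [neg_mul]
  set q : Fin n → ℂ := fun i => (starRingEnd ℂ) (a i) with hqdef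
  have hq : ∀ i, ‖q i‖ < 1 := fun i => by simpa [hqdef] using ha i
  have hq0 : ∃ j, q j = 0 := by simpa [hqdef] using ha0
  have hmu' : ‖(starRingEnd ℂ) mu‖ = 1 := by simpa using hmu
  obtain ⟨γ, hγ, h₁, h₂⟩ := W.exists_blaschke_relation hF hG hFG (c := (starRingEnd ℂ) mu)
    (c' := lam) (q := q) (b := b) hmu' hlam hq hb fun z hz => by
      rw [hsk z hz, ← hAB z hz]
      exact blaschke_conj_mul hmu ha (hk1 z hz)
  have hQ0 : ∀ z, ‖z‖ ≤ 1 →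
      γ * (∏ i, if q i = 0 then 1 else F z - (1 / q i + G (q i))) ≠ 0 := fun z hz => by
    refine mul_ne_zero hγ (Finset.prod_ne_zero_iff.2 fun i _ => ?_)
    split_ifs with h
    · exact one_ne_zero
    · exact W.left_sub_right_ne_zero hF hG hFG hz (hq i) h
  set P₁ : ℂ[X] := ∏ i, (X - C (F (b i))) with hP₁
  set P₂ : ℂ[X] := C γ * ∏ i, if q i = 0 then 1 else X - C (1 / q i + G (q i)) with hP₂
  have ev₁ : ∀ w, P₁.eval w = ∏ i, (w - F (b i)) := fun w => by
    simp [hP₁, eval_prod]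
  have ev₂ : ∀ w, P₂.eval w = γ * ∏ i, if q i = 0 then 1 else w - (1 / q i + G (q i)) := fun w => by
    rw [hP₂, eval_mul, eval_C, eval_prod]
    congr 1
    refine Finset.prod_congr rfl fun i _ => ?_
    split_ifs <;> simp
  have hΓ : {z : ℂ | ‖P₁.eval z‖ = ‖P₂.eval z‖} = F '' sphere 0 1 := by
    ext w
    rw [mem_ofPred_eq, ev₁, ev₂]
    constructor
    · intro h
      rcases W.exists_preimage hF hG hFG w with ⟨z, hz, rfl⟩ | ⟨ζ, hζ, hζ0, rfl⟩
      · refine ⟨z, ?_, rfl⟩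
        rw [mem_sphere_zero_iff_norm]
        by_contra hne
        have hB := norm_blaschke_lt_one hn hlam hb (hz.lt_of_ne hne)
        rw [h₁ z hz, norm_mul] at h
        nlinarith [norm_pos_iff.2 (hQ0 z hz)]
      · exfalso
        have hC := norm_blaschke_lt_one hn hmu' hq hζ
        rw [← h₂ ζ hζ.le hζ0, norm_mul] at h
        have h0 : ∏ i, (1 / ζ + G ζ - F (b i)) ≠ 0 := Finset.prod_ne_zero_iff.2 fun i _ =>
          W.right_sub_left_ne_zero hF hG hFG (hb i) hζ.le hζ0
        nlinarith [norm_pos_iff.2 h0]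
    · rintro ⟨z, hz, rfl⟩
      have hz1 : ‖z‖ = 1 := by simpa using hz
      rw [h₁ z hz1.le, norm_mul, norm_blaschke_eq_one hlam hb hz1, one_mul]
  refine ⟨P₁, P₂, F, fun w => w + G w⁻¹, ?_, ?_, natDegree_prod_ite_lt hq0 _ _, ?_,
    fun z hz => ?_⟩
  · refine IsCoprime.mul_right ?_ (IsCoprime.prod_left fun i _ => IsCoprime.prod_right fun j _ => ?_)
    · exact isCoprime_one_right.of_isCoprime_of_dvd_right ((isUnit_C.2 hγ.isUnit).dvd)
    · split_ifs with h
      · exact isCoprime_one_right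
      · exact isCoprime_X_sub_C_of_isUnit_sub
          (W.left_sub_right_ne_zero hF hG hFG (hb i).le (hq j) h).isUnit
  · rw [hP₁, natDegree_prod_of_monic _ _ fun i _ => monic_X_sub_C _]
    simp
  · rw [hΓ]
    exact W.conformalPair hF hG hFG
  · rw [hFG z hz, hsk z hz]
    simp
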